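/- arXiv:2109.14877 — 2 statements merged into one kernel-verified Lean document; each statement's English description precedes it below -/
import Mathlib

section
/- Let T be a small countable complete first-order theory, M ⊨ T, and B ⊆ M countable. Then there exists a countable model A ⊨ T with B ⊆ A such that: (1) for every finite tuple ā from A there is a finite tuple b̄ from B such that tp(ā/b̄) is principal; (2) for every model C ⊨ T with B ⊆ C, the finite diagram of A is contained in the finite diagram of C, D(A) ⊆ D(C); consequently (3) any two countable models satisfying (1) and (2) for the same set B have the same finite diagram. -/
namespace Paper

open FirstOrder FirstOrder.Language Set

universe u v w x y

variable (L : FirstOrder.Language.{u, v})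

/-- A theory is *small* if for every `n` it has only countably many complete `n`-types
over the empty set. -/
def IsSmall (T : L.Theory) : Prop := ∀ n : ℕ, Countable (T.CompleteType (Fin n))

section Basic

variable {M : Type w} [L.Structure M]

/-- `M` is ω-saturated: every set of 1-formulas over finitely many parameters that is
finitely satisfiable in `M` is realized in `M`. -/
def OmegaSaturated (M : Type w) [L.Structure M] : Prop :=
  ∀ (k : ℕ) (c : Fin k → M) (S : Set (L.Formula (Fin k ⊕ Fin 1))),
    (∀ S₀ : Finset (L.Formula (Fin k ⊕ Fin 1)), ↑S₀ ⊆ S →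
        ∃ a : M, ∀ φ ∈ S₀, Formula.Realize φ (Sum.elim c fun _ => a)) →
    ∃ a : M, ∀ φ ∈ S, Formula.Realize φ (Sum.elim c fun _ => a)

/-- The complete type of a tuple over the empty parameter set (as a set of formulas). -/
def tp0 {γ : Type*} (a : γ → M) : Set (L.Formula γ) := {φ | φ.Realize a}

/-- The complete type of a tuple `a` over the parameters `c`. -/
def tpT {β γ : Type*} (c : β → M) (a : γ → M) : Set (L.Formula (β ⊕ γ)) :=
  {φ | φ.Realize (Sum.elim c a)}

/-- The complete 1-type of an element `a` over the parameters `c`. -/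
def tp1 {β : Type*} (c : β → M) (a : M) : Set (L.Formula (β ⊕ Fin 1)) :=
  {φ | φ.Realize (Sum.elim c fun _ => a)}

/-- `tp(a/c)` is principal (isolated by a single formula). -/
def IsPrincipalT {β γ : Type*} (c : β → M) (a : γ → M) : Prop :=
  ∃ φ ∈ tpT L c a, ∀ a' : γ → M,
    Formula.Realize φ (Sum.elim c a') → tpT L c a' = tpT L c a

/-- The 1-type `tp(a/c)` is principal. -/
def IsPrincipal1 {β : Type*} (c : β → M) (a : M) : Prop :=
  ∃ φ ∈ tp1 L c a, ∀ a' : M,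
    Formula.Realize φ (Sum.elim c fun _ => a') → tp1 L c a' = tp1 L c a

/-- `g : B → N` is a partial elementary map (this is the meaning of "`B ⊆ N`" for a
subset `B` of another model). -/
def PartialElem {M : Type w} {N : Type x} [L.Structure M] [L.Structure N]
    (B : Set M) (g : B → N) : Prop :=
  ∀ (n : ℕ) (φ : L.Formula (Fin n)) (b : Fin n → B),
    Formula.Realize φ (fun i => (b i : M)) ↔ Formula.Realize φ (fun i => g (b i))

/-- The finite diagram of `M` is contained in the finite diagram of `N`: every complete
type over `∅` realized in `M` is realized in `N`. -/
def FinDiagSubset (M : Type w) (N : Type x) [L.Structure M] [L.Structure N] : Prop :=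
  ∀ (n : ℕ) (a : Fin n → M), ∃ b : Fin n → N, tp0 L a = tp0 L b

/-- The dowry of `B₁` is contained in the dowry of `B₂`. -/
def DowrySubset {M : Type w} [L.Structure M] (B₁ B₂ : Set M) : Prop :=
  ∀ (n : ℕ) (b₁ : Fin n → B₁), ∃ b₂ : Fin n → B₂,
    tp0 L (fun i => (b₁ i : M)) = tp0 L (fun i => (b₂ i : M))

/-- `A` (together with the identification `e` of `B` with a subset of `A`) is a model
obtained by the construction of Theorem 2 over the countable set `B`: a countable model of
`T` containing `B` in which every finite tuple has a principal type over some finite tuple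
from `B` extending any prescribed finite tuple from `B`. -/
def IsConstructedOver (T : L.Theory) {M : Type w} [L.Structure M] (B : Set M)
    (A : Type x) [L.Structure A] (e : B → A) : Prop :=
  Countable A ∧ T.Model A ∧ PartialElem L B e ∧
    ∀ (n : ℕ) (a : Fin n → A) (k₀ : ℕ) (b₀ : Fin k₀ → B),
      ∃ (k : ℕ) (b : Fin k → B), (∀ j, ∃ i, b i = b₀ j) ∧
        IsPrincipalT L (fun i => e (b i)) a

/-- `N` is a homogeneous structure. -/
def IsHomogeneous (N : Type x) [L.Structure N] : Prop :=
  ∀ (n : ℕ) (a b : Fin n → N), tp0 L a = tp0 L b →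
    ∀ c : N, ∃ d : N, tp0 L (Fin.snoc a c) = tp0 L (Fin.snoc b d)

/-- `p ⊥ʷ q`: weak orthogonality of the two types, witnessed inside the (sufficiently
saturated) structure `N`. -/
def WeaklyOrthogonalIn (N : Type x) [L.Structure N] {k m : ℕ}
    (p : Set (L.Formula (Fin k))) (q : Set (L.Formula (Fin m))) : Prop :=
  ∀ (a₁ a₂ : Fin k → N) (b₁ b₂ : Fin m → N),
    tp0 L a₁ = p → tp0 L a₂ = p → tp0 L b₁ = q → tp0 L b₂ = q →
      tp0 L (Fin.append a₁ b₁) = tp0 L (Fin.append a₂ b₂)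

end Basic

/-- `I(T, ℵ₀) = 2^{ℵ₀}`: the theory `T` has continuum many pairwise non-isomorphic
countable models. -/
def HasContinuumManyCountableModels (T : L.Theory) : Prop :=
  ∃ f : Set ℕ → Theory.ModelType.{u, v, max u v} T,
    (∀ s, Countable (f s)) ∧
    ∀ s t : Set ℕ, s ≠ t → IsEmpty ((f s) ≃[L] (f t))

section Ordered

variable {M : Type w} [L.Structure M] [LinearOrder M]

/-- The set of realizations in `M` of the 1-type `tp(a₀/c)`. -/
def pSet {k : ℕ} (c : Fin k → M) (a₀ : M) : Set M := {x | tp1 L c x = tp1 L c a₀}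

/-- `φ(x, y)` holds of `(x, y)` over the parameters `c`. -/
def real2 {k : ℕ} (c : Fin k → M) (φ : L.Formula (Fin k ⊕ Fin 2)) (x y : M) : Prop :=
  Formula.Realize φ (Sum.elim c ![x, y])

/-- `φ(M, α)`, the set defined by `φ(x, α)`. -/
def phiSet {k : ℕ} (c : Fin k → M) (φ : L.Formula (Fin k ⊕ Fin 2)) (α : M) : Set M :=
  {x | real2 L c φ x α}

/-- `S` is convex in `B`. -/
def ConvexIn {M : Type w} [LinearOrder M] (S B : Set M) : Prop :=
  ∀ a ∈ S, ∀ b ∈ S, ∀ y ∈ B, a ≤ y → y ≤ b → y ∈ S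

/-- `φ(x,y)` is a `p`-preserving formula, `p = tp(a₀/c)`. -/
def PPreserving {k : ℕ} (c : Fin k → M) (a₀ : M) (φ : L.Formula (Fin k ⊕ Fin 2)) : Prop :=
  ∃ α ∈ pSet L c a₀, ∃ γ₁ ∈ pSet L c a₀, ∃ γ₂ ∈ pSet L c a₀,
    (pSet L c a₀ ∩ (phiSet L c φ α \ {α})).Nonempty ∧
    ∀ z ∈ phiSet L c φ α, γ₁ < z ∧ z < γ₂

/-- `φ(x,y)` is convex to the right on `p`. -/
def ConvexRight {k : ℕ} (c : Fin k → M) (a₀ : M) (φ : L.Formula (Fin k ⊕ Fin 2)) : Prop :=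
  ∃ α ∈ pSet L c a₀,
    ConvexIn (pSet L c a₀ ∩ phiSet L c φ α) Set.univ ∧
    α ∈ phiSet L c φ α ∧ ∀ z ∈ phiSet L c φ α, α ≤ z

/-- `φ(x,y)` is convex to the left on `p`. -/
def ConvexLeft {k : ℕ} (c : Fin k → M) (a₀ : M) (φ : L.Formula (Fin k ⊕ Fin 2)) : Prop :=
  ∃ α ∈ pSet L c a₀,
    ConvexIn (pSet L c a₀ ∩ phiSet L c φ α) Set.univ ∧
    α ∈ phiSet L c φ α ∧ ∀ z ∈ phiSet L c φ α, z ≤ α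

/-- `φ(x,y)` is a quasi-successor on `p`. -/
def IsQuasiSuccessor {k : ℕ} (c : Fin k → M) (a₀ : M)
    (φ : L.Formula (Fin k ⊕ Fin 2)) : Prop :=
  PPreserving L c a₀ φ ∧ (ConvexRight L c a₀ φ ∨ ConvexLeft L c a₀ φ) ∧
    ∀ α ∈ pSet L c a₀, ∀ β ∈ phiSet L c φ α ∩ pSet L c a₀,
      (pSet L c a₀ ∩ (phiSet L c φ β \ phiSet L c φ α)).Nonempty

/-- `CRF(p)`: the family of all `p`-preserving convex to the right `A`-formulas. -/
def CRF {k : ℕ} (c : Fin k → M) (a₀ : M) : Set (L.Formula (Fin k ⊕ Fin 2)) :=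
  {φ | PPreserving L c a₀ φ ∧ ConvexRight L c a₀ φ}

/-- `CRF(p)` is infinite (up to equivalence on `p`, i.e. infinitely many traces). -/
def CRFInfinite {k : ℕ} (c : Fin k → M) (a₀ : M) : Prop :=
  {g : M → Set M | ∃ φ ∈ CRF L c a₀,
    g = fun α => phiSet L c φ α ∩ pSet L c a₀}.Infinite

/-- `CRF(p)` has a greatest formula on `p`. -/
def HasGreatestCRF {k : ℕ} (c : Fin k → M) (a₀ : M) : Prop :=
  ∃ φ ∈ CRF L c a₀, ∀ ψ ∈ CRF L c a₀, ∀ α ∈ pSet L c a₀,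
    phiSet L c ψ α ∩ pSet L c a₀ ⊆ phiSet L c φ α ∩ pSet L c a₀

/-- `CRF(p)` has a least formula on `p`. -/
def HasLeastCRF {k : ℕ} (c : Fin k → M) (a₀ : M) : Prop :=
  ∃ φ ∈ CRF L c a₀, ∀ ψ ∈ CRF L c a₀, ∀ α ∈ pSet L c a₀,
    phiSet L c φ α ∩ pSet L c a₀ ⊆ phiSet L c ψ α ∩ pSet L c a₀

/-- `chain n x y` holds iff `x ∈ φⁿ(M, y)` (the `n`-fold iterate of `φ`). -/
def chain {k : ℕ} (c : Fin k → M) (φ : L.Formula (Fin k ⊕ Fin 2)) :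
    ℕ → M → M → Prop
  | 0, x, y => x = y
  | n + 1, x, y => ∃ z, chain c φ n z y ∧ real2 L c φ x z

/-- The neighborhood `V_{p,φ}(α)`. -/
def Vnb {k : ℕ} (c : Fin k → M) (a₀ : M) (φ : L.Formula (Fin k ⊕ Fin 2)) (α : M) :
    Set M :=
  {γ | γ ∈ pSet L c a₀ ∧ ∃ n : ℕ, chain L c φ n γ α ∨ chain L c φ n α γ}

/-- Every element of `S` precedes every element of `S'`. -/
def SetLT {M : Type w} [LinearOrder M] (S S' : Set M) : Prop :=
  ∀ a ∈ S, ∀ b ∈ S', a < b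

/-- The set of elements strictly above every member of `S` and strictly below every
member of `S'`. -/
def betweenSets {M : Type w} [LinearOrder M] (S S' : Set M) : Set M :=
  {y | (∀ a ∈ S, a < y) ∧ ∀ b ∈ S', y < b}

/-- The convex closure `φᶜ(M)` of the set defined by a 1-formula `φ` over parameters `c`. -/
def convCl {β : Type*} (c : β → M) (φ : L.Formula (β ⊕ Fin 1)) : Set M :=
  {y | ∃ y₁ y₂ : M, Formula.Realize φ (Sum.elim c fun _ => y₁) ∧
    Formula.Realize φ (Sum.elim c fun _ => y₂) ∧ y₁ ≤ y ∧ y ≤ y₂}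

/-- The convex type `tpᶜ(a/c)`, encoded as the set of 1-formulas `φ` over `c` whose
convex closure contains `a`. -/
def tpc {β : Type*} (c : β → M) (a : M) : Set (L.Formula (β ⊕ Fin 1)) :=
  {φ | a ∈ convCl L c φ}

/-- The set of realizations in `M` of the convex type `tpᶜ(a/c)`. -/
def tpcRealizers {β : Type*} (c : β → M) (a : M) : Set M :=
  {y | ∀ φ ∈ tp1 L c a, y ∈ convCl L c φ}

/-- `(α, β)` realizes the partial type `q₀(x, y)` associated with the quasi-successor `φ`. -/
def RealizesQ0 {k : ℕ} (c : Fin k → M) (a₀ : M) (φ : L.Formula (Fin k ⊕ Fin 2))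
    (α β : M) : Prop :=
  α < β ∧ α ∈ pSet L c a₀ ∧ β ∈ pSet L c a₀ ∧
  (∀ n : ℕ, ¬ chain L c φ n β α) ∧
  (∀ R : L.Formula (Fin k ⊕ Fin 2),
    (PPreserving L c a₀ R ∧ ConvexRight L c a₀ R ∧
      ∀ n : ℕ, ∀ α' ∈ pSet L c a₀, ∀ γ ∈ pSet L c a₀,
        chain L c φ n γ α' → γ ∈ phiSet L c R α') →
    real2 L c R β α) ∧
  (∀ Lf : L.Formula (Fin k ⊕ Fin 2),
    (PPreserving L c a₀ Lf ∧ ConvexLeft L c a₀ Lf ∧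
      ∀ n : ℕ, ∀ β' ∈ pSet L c a₀, ∀ γ ∈ pSet L c a₀,
        chain L c φ n β' γ → γ ∈ phiSet L c Lf β') →
    real2 L c Lf α β)

/-- The neighborhood `V_{p(M)}(α)` built from all of `CRF(p)`. -/
def VCRF {k : ℕ} (c : Fin k → M) (a₀ : M) (α : M) : Set M :=
  {γ | γ ∈ pSet L c a₀ ∧ ∃ φ ∈ CRF L c a₀, real2 L c φ α γ ∨ real2 L c φ γ α}

/-- `ε_{φ,Θ}(M, α) = (φ(α,·) ∨ φ(·,α)) ∩ Θ(M)`. -/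
def epsSet {k : ℕ} (c : Fin k → M) (θ : L.Formula (Fin k ⊕ Fin 1))
    (φ : L.Formula (Fin k ⊕ Fin 2)) (α : M) : Set M :=
  {y | (real2 L c φ α y ∨ real2 L c φ y α) ∧
    Formula.Realize θ (Sum.elim c fun _ => y)}

/-- `Θ ∈ p` is a formula with `p(M) = pᶜ(M) ∩ Θ(M)`. -/
def ThetaWitness {k : ℕ} (c : Fin k → M) (a₀ : M) (θ : L.Formula (Fin k ⊕ Fin 1)) :
    Prop :=
  pSet L c a₀ =
    tpcRealizers L c a₀ ∩ {y | Formula.Realize θ (Sum.elim c fun _ => y)}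

/-- The kernel `Ker_{p(M)}(α) = ⋂_{φ ∈ CRF(p)} ε_{φ,Θ}(M, α)`. -/
def KerSet {k : ℕ} (c : Fin k → M) (a₀ : M) (θ : L.Formula (Fin k ⊕ Fin 1)) (α : M) :
    Set M :=
  ⋂ φ ∈ CRF L c a₀, epsSet L c θ φ α

/-- The formulas of `CRF(p)` strictly smaller than `ψ` on `p`. -/
def SmallerCRF {k : ℕ} (c : Fin k → M) (a₀ : M) (ψ : L.Formula (Fin k ⊕ Fin 2)) :
    Set (L.Formula (Fin k ⊕ Fin 2)) :=
  {φ ∈ CRF L c a₀ | ∃ α ∈ pSet L c a₀,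
    phiSet L c φ α ∩ pSet L c a₀ ⊂ phiSet L c ψ α ∩ pSet L c a₀}

/-- The formulas of `CRF(p)` strictly greater than `ψ` on `p`. -/
def LargerCRF {k : ℕ} (c : Fin k → M) (a₀ : M) (ψ : L.Formula (Fin k ⊕ Fin 2)) :
    Set (L.Formula (Fin k ⊕ Fin 2)) :=
  {φ ∈ CRF L c a₀ | ∃ α ∈ pSet L c a₀,
    phiSet L c ψ α ∩ pSet L c a₀ ⊂ phiSet L c φ α ∩ pSet L c a₀}

/-- `V^ψ_{p(M)}(α)`. -/
def Vpsi {k : ℕ} (c : Fin k → M) (a₀ : M) (θ : L.Formula (Fin k ⊕ Fin 1))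
    (ψ : L.Formula (Fin k ⊕ Fin 2)) (α : M) : Set M :=
  ⋃ φ ∈ SmallerCRF L c a₀ ψ, epsSet L c θ φ α

/-- `Ker^ψ_{p(M)}(α)`. -/
def Kerpsi {k : ℕ} (c : Fin k → M) (a₀ : M) (θ : L.Formula (Fin k ⊕ Fin 1))
    (ψ : L.Formula (Fin k ⊕ Fin 2)) (α : M) : Set M :=
  ⋂ φ ∈ LargerCRF L c a₀ ψ, epsSet L c θ φ α

/-- `φ(x,y)` is equivalence-generating (for convex-to-the-right formulas). -/
def EquivGenR {k : ℕ} (c : Fin k → M) (a₀ : M) (φ : L.Formula (Fin k ⊕ Fin 2)) : Prop :=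
  ∀ α ∈ pSet L c a₀, ∀ β ∈ phiSet L c φ α ∩ pSet L c a₀,
    ∀ y : M, β ≤ y → (y ∈ phiSet L c φ α ↔ y ∈ phiSet L c φ β)

/-- `φ(x,y)` is equivalence-generating (for convex-to-the-left formulas). -/
def EquivGenL {k : ℕ} (c : Fin k → M) (a₀ : M) (φ : L.Formula (Fin k ⊕ Fin 2)) : Prop :=
  ∀ α ∈ pSet L c a₀, ∀ β ∈ phiSet L c φ α ∩ pSet L c a₀,
    ∀ y : M, y ≤ β → (y ∈ phiSet L c φ α ↔ y ∈ phiSet L c φ β)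

/-- The relation defined by the formula `E(x, y, b̄)` over parameters `c`. -/
def Erel {k m : ℕ} (c : Fin k → M) (E : L.Formula (Fin k ⊕ (Fin 2 ⊕ Fin m)))
    (b : Fin m → M) (x y : M) : Prop :=
  Formula.Realize E (Sum.elim c (Sum.elim ![x, y] b))

/-- `r` is an equivalence relation on `P`. -/
def IsEquivOn {M : Type w} (r : M → M → Prop) (P : Set M) : Prop :=
  (∀ x ∈ P, r x x) ∧ (∀ x ∈ P, ∀ y ∈ P, r x y → r y x) ∧
    (∀ x ∈ P, ∀ y ∈ P, ∀ z ∈ P, r x y → r y z → r x z)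

/-- The `r`-classes are convex in `P`. -/
def ClassesConvexIn {M : Type w} [LinearOrder M] (r : M → M → Prop) (P : Set M) : Prop :=
  ∀ x ∈ P, ConvexIn {y | y ∈ P ∧ r x y} P

/-- The `r`-classes are mutually dense in `P`. -/
def ClassesMutuallyDense {M : Type w} [LinearOrder M] (r : M → M → Prop) (P : Set M) :
    Prop :=
  ∀ x ∈ P, ∀ y ∈ P, ¬ r x y →
    ∀ u ∈ P, ∀ v ∈ P, r x u → r x v → u < v → ∃ w ∈ P, r y w ∧ u < w ∧ w < v

/-- Every `r`-class is partitioned into infinitely many infinite `r'`-classes. -/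
def RefinedIntoInfinitelyMany {M : Type w} (r r' : M → M → Prop) (P : Set M) : Prop :=
  (∀ x ∈ P, ∀ y ∈ P, r' x y → r x y) ∧
  (∀ x ∈ P, ∀ y ∈ P, r x y → {z | z ∈ P ∧ r' y z}.Infinite) ∧
  ∀ x ∈ P, {C : Set M | ∃ y, y ∈ P ∧ r x y ∧ C = {z | z ∈ P ∧ r' y z}}.Infinite

/-- The Restriction on the (linearly ordered) theory of `M`. -/
def SatisfiesRestriction (M : Type w) [L.Structure M] [LinearOrder M] : Prop :=
  ∀ (k : ℕ) (c : Fin k → M) (a₀ : M),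
    (∀ (m : ℕ) (E : L.Formula (Fin k ⊕ (Fin 2 ⊕ Fin m))) (bs : ℕ → Fin m → M),
        ¬ ∀ i : ℕ,
            IsEquivOn (Erel L c E (bs i)) (pSet L c a₀) ∧
            ClassesConvexIn (Erel L c E (bs i)) (pSet L c a₀) ∧
            ClassesMutuallyDense (Erel L c E (bs i)) (pSet L c a₀) ∧
            RefinedIntoInfinitelyMany (Erel L c E (bs i)) (Erel L c E (bs (i + 1)))
              (pSet L c a₀)) ∧
    {q : Set (L.Formula (Fin k ⊕ Fin 1)) | ∃ y : M,
      tpc L c y = tpc L c a₀ ∧ q = tp1 L c y}.Finite ∧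
    ∀ φ : L.Formula (Fin k ⊕ Fin 2),
      (PPreserving L c a₀ φ → ConvexRight L c a₀ φ → EquivGenR L c a₀ φ) ∧
      (PPreserving L c a₀ φ → ConvexLeft L c a₀ φ → EquivGenL L c a₀ φ)

/-- `M₀` is a prime model (of the complete theory of `M`) over the finite tuple `xs`:
it is a countable atomic elementary substructure of `M` containing `xs`. -/
def IsPrimeOver (M₀ : L.ElementarySubstructure M) {r : ℕ} (xs : Fin r → M) : Prop :=
  (∀ i, xs i ∈ M₀) ∧ Countable M₀ ∧
    ∀ (n : ℕ) (a : Fin n → M₀), IsPrincipalT L xs (fun i => (a i : M))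

/-- The 1-type `p = tp(a₀/c)` is extremely trivial. -/
def ExtremelyTrivial {k : ℕ} (c : Fin k → M) (a₀ : M) : Prop :=
  ∀ n : ℕ, 1 ≤ n → ∀ βs : Fin n → M, (∀ i, βs i ∈ pSet L c a₀) →
    ∀ M₀ : L.ElementarySubstructure M, IsPrimeOver L M₀ (Fin.append c βs) →
      {y | y ∈ pSet L c a₀ ∧ y ∈ M₀} = Set.range βs

end Ordered

section Generic

/-- Rasiowa–Sikorski for formulas: given a nonempty set `V` of assignments into `M` and countably
many sets of formulas, each dense with respect to `V`, some assignment `w` into a model of the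
complete theory of `M` satisfies everything that holds throughout `V` and meets every dense set. -/
theorem exists_generic_assignment {L : FirstOrder.Language.{u, v}} {M : Type w} [L.Structure M]
    [Nonempty M] {γ : Type x} {ι : Type y} [Countable ι] (V : Set (γ → M)) (hV : V.Nonempty)
    (D : ι → Set (L.Formula γ))
    (hD : ∀ i (φ : L.Formula γ), (∃ v ∈ V, φ.Realize v) →
      ∃ χ ∈ D i, ∃ v ∈ V, φ.Realize v ∧ χ.Realize v) :
    ∃ (N : Theory.ModelType.{u, v, max u v x} (L.completeTheory M)) (s : γ → N),
      (∀ φ : L.Formula γ, (∀ v ∈ V, φ.Realize v) → φ.Realize s) ∧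
      ∀ i, ∃ χ ∈ D i, χ.Realize s := by
  classical
  let P : Type _ := {φ : L.Formula γ // ∃ v ∈ V, φ.Realize v}
  let : Preorder P :=
    { le := fun p q => ∀ v ∈ V, q.1.Realize v → p.1.Realize v
      le_refl := fun _ _ _ h => h
      le_trans := fun _ _ _ hpq hqr v hv h => hpq v hv (hqr v hv h) }
  let 𝒟 : ι → Order.Cofinal P := fun i =>
    { carrier := {p | ∃ χ ∈ D i, ∀ v ∈ V, p.1.Realize v → χ.Realize v}
      isCofinal := by
        rintro ⟨φ, hφ⟩
        obtain ⟨χ, hχ, v, hv, h₁, h₂⟩ := hD i φ hφ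
        refine ⟨⟨φ ⊓ χ, v, hv, by simpa using ⟨h₁, h₂⟩⟩, ⟨χ, hχ, fun v _ h => ?_⟩,
          fun v _ h => ?_⟩
        · exact (Formula.realize_inf.1 h).2
        · exact (Formula.realize_inf.1 h).1 }
  have : Encodable ι := Encodable.ofCountable ι
  obtain ⟨v₀, hv₀⟩ := hV
  let I := Order.idealOfCofinals (⟨⊤, v₀, hv₀, by simp⟩ : P) 𝒟
  let Γ : Set (L.Formula γ) := {φ | ∃ p ∈ I, ∀ v ∈ V, p.1.Realize v → φ.Realize v}
  have hfin : ∀ S : Finset (L.Formula γ), (S : Set _) ⊆ Γ →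
      ∃ p ∈ I, ∀ φ ∈ S, ∀ v ∈ V, p.1.Realize v → φ.Realize v := by
    intro S
    induction S using Finset.induction with
    | empty => exact fun _ => ⟨_, Order.mem_idealOfCofinals _ _, by simp⟩
    | insert φ S _ ih =>
      intro h
      rw [Finset.coe_insert, Set.insert_subset_iff] at h
      obtain ⟨p, hp, hpS⟩ := ih h.2
      obtain ⟨q, hq, hqφ⟩ := h.1
      obtain ⟨r, hr, hpr, hqr⟩ := I.directed p hp q hq
      refine ⟨r, hr, fun ψ hψ v hv hrv => ?_⟩
      rcases Finset.mem_insert.1 hψ with rfl | hψ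
      · exact hqφ v hv (hqr v hv hrv)
      · exact hpS ψ hψ v hv (hpr v hv hrv)
  have hsat : ((L.lhomWithConstants γ).onTheory (L.completeTheory M) ∪
      Formula.equivSentence '' Γ).IsSatisfiable := by
    rw [Theory.isSatisfiable_iff_isFinitelySatisfiable]
    intro T₀ hT₀
    obtain ⟨p, hp, hpS⟩ := hfin
      ((T₀.image Formula.equivSentence.symm).filter (· ∈ Γ)) (fun φ hφ => by simp_all)
    obtain ⟨v, hv, hpv⟩ := p.2
    let := constantsOn.structure v
    have : M ⊨ (T₀ : L[[γ]].Theory) := by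
      refine ⟨fun σ hσ => ?_⟩
      rcases hT₀ hσ with h | ⟨φ, hφ, rfl⟩
      · have : M ⊨ (L.lhomWithConstants γ).onTheory (L.completeTheory M) :=
          (LHom.onTheory_model _ _).2 inferInstance
        exact this.realize_of_mem _ h
      · have := hpS φ (by
          simp only [Finset.mem_filter, Finset.mem_image]
          exact ⟨⟨_, hσ, by simp⟩, hφ⟩) v hv hpv
        rw [Formula.realize_equivSentence]
        exact this
    exact Theory.Model.isSatisfiable M
  obtain ⟨q, hq⟩ : {q : (L.completeTheory M).CompleteType γ |
      Formula.equivSentence '' Γ ⊆ (q : L[[γ]].Theory)}.Nonempty := by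
    rw [Set.nonempty_iff_ne_empty, Ne, Theory.CompleteType.setOfPred_subset_eq_empty_iff, not_not]
    exact hsat
  obtain ⟨N, s, rfl⟩ := Theory.exists_modelType_is_realized_in _ q
  have hs : ∀ φ ∈ Γ, φ.Realize s := fun φ hφ =>
    Theory.CompleteType.formula_mem_typeOf.1 (hq ⟨φ, hφ, rfl⟩)
  refine ⟨N, s, fun φ hφ => hs φ ⟨_, Order.mem_idealOfCofinals _ _, fun v hv _ => hφ v hv⟩,
    fun i => ?_⟩
  obtain ⟨p, ⟨χ, hχ, hpχ⟩, hp⟩ := Order.cofinal_meets_idealOfCofinals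
    (⟨⊤, v₀, hv₀, by simp⟩ : P) 𝒟 i
  exact ⟨χ, hχ, hs χ ⟨p, hp, hpχ⟩⟩

end Generic

section Complete

variable {L : FirstOrder.Language.{u, v}}

/-- Over the parameters `c`, the formula `θ` decides every formula. -/
def IsCompleteOver {M : Type w} [L.Structure M] {β γ : Type*} (c : β → M)
    (θ : L.Formula (β ⊕ γ)) : Prop :=
  ∀ ψ : L.Formula (β ⊕ γ),
    (∀ a, θ.Realize (Sum.elim c a) → ψ.Realize (Sum.elim c a)) ∨
      ∀ a, θ.Realize (Sum.elim c a) → ¬ ψ.Realize (Sum.elim c a)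

/-- In a small theory, isolated types over finitely many parameters are dense. -/
theorem IsSmall.exists_isCompleteOver {M : Type w} [L.Structure M] [Nonempty M]
    (hsmall : IsSmall L (L.completeTheory M)) {k n : ℕ} (c : Fin k → M)
    (φ : L.Formula (Fin k ⊕ Fin n)) (hφ : ∃ a, φ.Realize (Sum.elim c a)) :
    ∃ θ : L.Formula (Fin k ⊕ Fin n), IsCompleteOver c θ ∧
      (∃ a, θ.Realize (Sum.elim c a)) ∧
      ∀ a, θ.Realize (Sum.elim c a) → φ.Realize (Sum.elim c a) := by
  classical
  by_contra! hno
  let e : Fin k ⊕ Fin n ≃ Fin (k + n) := finSumFinEquiv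
  have := hsmall (k + n)
  obtain ⟨N, s, -, hs⟩ := exists_generic_assignment (L := L)
    {v : Fin k ⊕ Fin n → M | v ∘ Sum.inl = c ∧ φ.Realize v}
    (by
      obtain ⟨a, ha⟩ := hφ
      exact ⟨_, by simp, ha⟩)
    (fun p : (L.completeTheory M).CompleteType (Fin (k + n)) =>
      {χ | Formula.equivSentence (Formula.relabel e χ) ∉ p})
    (by
      rintro p χ ⟨v, ⟨rfl, hφv⟩, hχv⟩
      by_contra! hp
      have hsplit : ¬ IsCompleteOver (v ∘ Sum.inl) (φ ⊓ χ) := by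
        intro h
        obtain ⟨a, ha, hna⟩ := hno _ h ⟨v ∘ Sum.inr, by
          rw [Sum.elim_comp_inl_inr]; simpa using ⟨hφv, hχv⟩⟩
        exact hna (Formula.realize_inf.1 ha).1
      simp only [IsCompleteOver, not_forall, not_or, not_not, Formula.realize_inf] at hsplit
      obtain ⟨ψ, ⟨a, ⟨haφ, haχ⟩, ha⟩, ⟨b, ⟨hbφ, hbχ⟩, hb⟩⟩ := hsplit
      have h₁ : Formula.equivSentence (ψ.relabel e) ∈ p := by
        by_contra h
        exact hp ψ h _ ⟨by simp, hbφ⟩ hbχ hb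
      have h₂ : Formula.equivSentence (Formula.relabel e (∼ψ)) ∈ p := by
        by_contra h
        exact hp (∼ψ) h _ ⟨by simp, haφ⟩ haχ (by simpa using ha)
      obtain ⟨N, t, rfl⟩ := Theory.exists_modelType_is_realized_in _ p
      rw [Theory.CompleteType.formula_mem_typeOf, Formula.realize_relabel] at h₁ h₂
      exact h₂ h₁)
  obtain ⟨χ, hχ, hχs⟩ := hs ((L.completeTheory M).typeOf (s ∘ e.symm))
  refine hχ ?_
  rw [Theory.CompleteType.formula_mem_typeOf, Formula.realize_relabel]
  simpa [Function.comp_assoc] using hχs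

/-- Completeness of a formula over parameters is preserved by partial elementary maps. -/
theorem IsCompleteOver.map {M : Type w} {N : Type x} [L.Structure M] [L.Structure N] {B : Set M}
    {g : B → N} (hg : PartialElem L B g) {k : ℕ} {γ : Type*} [Finite γ] {b : Fin k → B}
    {θ : L.Formula (Fin k ⊕ γ)} (hθ : IsCompleteOver (fun i => (b i : M)) θ) :
    IsCompleteOver (fun i => g (b i)) θ := by
  intro ψ
  have h₁ := hg k ((θ.imp ψ).iAlls γ) b
  have h₂ := hg k ((θ.imp (∼ψ)).iAlls γ) b
  simp only [Formula.realize_iAlls, Formula.realize_imp, Formula.realize_not] at h₁ h₂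
  exact (hθ ψ).imp h₁.1 h₂.1

/-- A subtuple of a tuple realizing a complete formula over `c` has principal type over `c`. -/
theorem IsCompleteOver.isPrincipalT_comp {M : Type w} [L.Structure M] {β γ δ : Type*}
    [Finite γ] [Finite δ] {c : β → M} {θ : L.Formula (β ⊕ γ)} (hθ : IsCompleteOver c θ)
    {a : γ → M} (ha : θ.Realize (Sum.elim c a)) (f : δ → γ) : IsPrincipalT L c (a ∘ f) := by
  let η : L.Formula (β ⊕ δ) := ((θ.relabel (Sum.map Sum.inl id)) ⊓
    Formula.iInf fun j : δ => (Term.var (Sum.inl (Sum.inr j))).equal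
      (Term.var (Sum.inr (f j)))).iExs γ
  have hη : ∀ a' : δ → M, η.Realize (Sum.elim c a') ↔
      ∃ d : γ → M, θ.Realize (Sum.elim c d) ∧ a' = d ∘ f := by
    intro a'
    have : ∀ d : γ → M, Sum.elim (Sum.elim c a') d ∘ Sum.map Sum.inl id = Sum.elim c d := by
      intro d; ext (_ | _) <;> rfl
    simp [η, Formula.realize_iExs, Formula.realize_relabel, Formula.realize_equal, this,
      funext_iff]
  refine ⟨η, (hη _).2 ⟨a, ha, rfl⟩, fun a' ha' => ?_⟩
  obtain ⟨d, hd, rfl⟩ := (hη _).1 ha'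
  ext ψ
  have hψ : ∀ d : γ → M, (ψ.relabel (Sum.map id f)).Realize (Sum.elim c d) ↔
      ψ.Realize (Sum.elim c (d ∘ f)) := by
    intro d
    rw [Formula.realize_relabel, Sum.elim_comp_map, Function.comp_id]
  have := hθ (ψ.relabel (Sum.map id f))
  simp only [hψ] at this
  rcases this with h | h
  · exact iff_of_true (h d hd) (h a ha)
  · exact iff_of_false (h d hd) (h a ha)

end Complete

section LocallyAtomic

variable {L : FirstOrder.Language.{u, v}}

/-- A structure in which every finite tuple has a principal type over a finite tuple from `B`
has the least finite diagram among the models containing `B`. -/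
theorem finDiagSubset_of_isPrincipalT {M : Type w} [L.Structure M] {B : Set M}
    {A : Type x} [L.Structure A] {C : Type y} [L.Structure C] {e : B → A} {g : B → C}
    (he : PartialElem L B e) (hg : PartialElem L B g)
    (hA : ∀ (n : ℕ) (a : Fin n → A), ∃ (k : ℕ) (b : Fin k → B),
      IsPrincipalT L (fun i => e (b i)) a) : FinDiagSubset L A C := by
  intro n a
  obtain ⟨k, b, φ, hφa, hφ⟩ := hA n a
  have transfer : ∀ χ : L.Formula (Fin k), χ.Realize (fun i => e (b i)) →
      χ.Realize (fun i => g (b i)) := fun χ h => (hg k χ b).1 ((he k χ b).2 h)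
  obtain ⟨c, hc⟩ := Formula.realize_iExs.1
    (transfer (φ.iExs (Fin n)) (Formula.realize_iExs.2 ⟨a, hφa⟩))
  have key : ∀ χ : L.Formula (Fin n), χ.Realize a → χ.Realize c := by
    intro χ hχ
    have := transfer ((φ.imp (χ.relabel Sum.inr)).iAlls (Fin n)) (by
      rw [Formula.realize_iAlls]
      intro a'
      rw [Formula.realize_imp]
      intro ha'
      have hmem : χ.relabel Sum.inr ∈ tpT L (fun i => e (b i)) a := by
        simpa [tpT, Formula.realize_relabel] using hχ
      rw [← hφ a' ha'] at hmem
      exact hmem)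
    rw [Formula.realize_iAlls] at this
    have := Formula.realize_imp.1 (this c) hc
    simpa [Formula.realize_relabel] using this
  refine ⟨c, Set.ext fun χ => ⟨key χ, fun h => ?_⟩⟩
  by_contra hn
  exact key (∼χ) hn h

/-- The truth of a formula depends only on the values of finitely many variables. -/
theorem realize_congr_of_eqOn_freeVarFinset {γ : Type*} [DecidableEq γ] (φ : L.Formula γ)
    {M : Type w} [L.Structure M] {s t : γ → M} (h : ∀ i ∈ φ.freeVarFinset, s i = t i) :
    φ.Realize s ↔ φ.Realize t := by
  have h₁ := BoundedFormula.realize_restrictFreeVar (φ := φ) (f := id)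
    (v := fun i => s i) (xs := (default : Fin 0 → M)) s (fun _ => rfl)
  have h₂ := BoundedFormula.realize_restrictFreeVar (φ := φ) (f := id)
    (v := fun i => s i) (xs := (default : Fin 0 → M)) t (fun i => h i i.2)
  exact h₁.symm.trans h₂

/-- A formula in parameters from `B` and variables from `ℕ` is the relabelling of one in finite
index types. -/
theorem exists_finite_support {B : Type x} (φ : L.Formula (B ⊕ ℕ)) (n : ℕ) :
    ∃ (k m : ℕ) (b : Fin k → B) (φ' : L.Formula (Fin k ⊕ Fin m)), n ≤ m ∧
      ∀ {M : Type w} [L.Structure M] (s : B ⊕ ℕ → M),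
        φ'.Realize (s ∘ Sum.map b Fin.val) ↔ φ.Realize s := by
  classical
  let S := φ.freeVarFinset
  let l := S.toLeft.equivFin
  obtain ⟨m, hm⟩ := S.toRight.exists_nat_subset_range
  let f : S → Fin S.toLeft.card ⊕ Fin (max n m)
    | ⟨Sum.inl x, hx⟩ => Sum.inl (l ⟨x, Finset.mem_toLeft.2 hx⟩)
    | ⟨Sum.inr i, hi⟩ => Sum.inr ⟨i, lt_max_of_lt_right
        (Finset.mem_range.1 (hm (Finset.mem_toRight.2 hi)))⟩
  refine ⟨_, _, fun i => (l.symm i : B), φ.restrictFreeVar f, le_max_left _ _, fun s => ?_⟩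
  refine BoundedFormula.realize_restrictFreeVar s ?_
  rintro ⟨x | i, h⟩ <;> simp [f]

/-- The range of an assignment witnessing every existential formula meets definable sets. -/
theorem meetsDefinable_range {N : Type w} [L.Structure N] {γ : Type*} {δ : Type*} (s : γ → N)
    (f : δ → γ)
    (h : ∀ ψ : L.Formula (γ ⊕ Fin 1), (∃ a, ψ.Realize (Sum.elim s a)) →
      ∃ d : δ, ψ.Realize (Sum.elim s fun _ => s (f d))) :
    L.MeetsDefinable (Set.range (s ∘ f)) := by
  rintro D ⟨x, hx⟩ ⟨φ, hφ⟩
  choose i hi using fun y : Set.range (s ∘ f) => y.2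
  let ψ : L.Formula (γ ⊕ Fin 1) :=
    Formula.relabel (Sum.map (f ∘ i) id) (BoundedFormula.constantsVarsEquiv φ : L.Formula _)
  have hψ : ∀ a : Fin 1 → N, ψ.Realize (Sum.elim s a) ↔ a 0 ∈ D := by
    intro a
    have h₁ : a 0 ∈ D ↔ φ.Realize a := by
      change a ∈ {v : Fin 1 → N | v 0 ∈ D} ↔ _
      rw [hφ]; rfl
    have h₂ : s ∘ f ∘ i = fun y : Set.range (s ∘ f) =>
        ((L.con y : L[[Set.range (s ∘ f)]].Constants) : N) := by
      funext y
      simpa using hi y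
    rw [h₁, Formula.realize_relabel, Sum.elim_comp_map, Function.comp_id, h₂]
    exact BoundedFormula.realize_constantsVarsEquiv
  obtain ⟨d, hd⟩ := h ψ ⟨fun _ => x, (hψ _).2 hx⟩
  exact ⟨_, (hψ _).1 hd, d, rfl⟩

/-- Over a countable subset of a model of a small countable theory there is a countable model
in which every finite tuple has a principal type over finitely many elements of the subset. -/
theorem IsSmall.exists_locallyAtomic (hL : Countable L.Symbols) {M : Type w} [L.Structure M]
    [Nonempty M] (hsmall : IsSmall L (L.completeTheory M)) (B : Set M) (hB : B.Countable) :
    ∃ (A : Theory.ModelType.{u, v, max u v w} (L.completeTheory M)) (e : B → A),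
      Countable A ∧ PartialElem L B e ∧
      ∀ (n : ℕ) (a : Fin n → A), ∃ (k : ℕ) (b : Fin k → B),
        IsPrincipalT L (fun i => e (b i)) a := by
  classical
  have := hB.to_subtype
  let D : L.Formula ((B ⊕ ℕ) ⊕ Fin 1) ⊕ ℕ → Set (L.Formula (B ⊕ ℕ)) := Sum.elim
    (fun ψ => {χ | χ = ∼(ψ.iExs (Fin 1)) ∨
      ∃ d : ℕ, χ = ψ.relabel (Sum.elim id fun _ => Sum.inr d)})
    (fun n => {χ | ∃ (k m : ℕ) (b : Fin k → B) (θ : L.Formula (Fin k ⊕ Fin m)), n ≤ m ∧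
      IsCompleteOver (fun i => (b i : M)) θ ∧ χ = θ.relabel (Sum.map b Fin.val)})
  obtain ⟨N, s, hVs, hDs⟩ := exists_generic_assignment (L := L)
    {s : B ⊕ ℕ → M | s ∘ Sum.inl = Subtype.val}
    ⟨Sum.elim Subtype.val fun _ => Classical.arbitrary M, by simp⟩ D (by
      rintro (ψ | n) φ ⟨s, hs, hφ⟩
      · by_cases h : ∃ a, ψ.Realize (Sum.elim s a)
        · obtain ⟨a, ha⟩ := h
          obtain ⟨d, hd⟩ := Infinite.exists_notMem_finset
            (φ.freeVarFinset.toRight ∪ ψ.freeVarFinset.toLeft.toRight)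
          simp only [Finset.mem_union, Finset.mem_toRight, Finset.mem_toLeft, not_or] at hd
          refine ⟨_, Or.inr ⟨d, rfl⟩, Function.update s (Sum.inr d) (a 0), ?_, ?_, ?_⟩
          · rw [← hs]; funext x; simp
          · refine (realize_congr_of_eqOn_freeVarFinset φ fun i hi => ?_).1 hφ
            rw [Function.update_of_ne]
            rintro rfl
            exact hd.1 hi
          · rw [Formula.realize_relabel]
            refine (realize_congr_of_eqOn_freeVarFinset ψ fun i hi => ?_).1 ha
            rcases i with i | i
            · simp only [Sum.elim_inl, Function.comp_apply, id]
              rw [Function.update_of_ne]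
              rintro rfl
              exact hd.2 hi
            · simp [Subsingleton.elim i 0]
        · exact ⟨_, Or.inl rfl, s, hs, hφ, by simpa [Formula.realize_iExs] using h⟩
      · obtain ⟨k, m, b, φ', hnm, hφ'⟩ := exists_finite_support.{u, v, w, w} φ n
        obtain ⟨θ, hθ, ⟨a, ha⟩, hθφ⟩ := hsmall.exists_isCompleteOver (fun i => (b i : M)) φ'
          ⟨fun i => s (Sum.inr i), by
            rw [← hφ'] at hφ
            convert hφ using 1
            funext i
            rcases i with i | i
            · exact (congrFun hs (b i)).symm
            · rfl⟩
        let t : B ⊕ ℕ → M := Sum.elim Subtype.val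
          fun i => if h : i < m then a ⟨i, h⟩ else Classical.arbitrary M
        have ht : t ∘ Sum.map b Fin.val = Sum.elim (fun i => (b i : M)) a := by
          funext i
          rcases i with i | i <;> simp [t]
        refine ⟨_, ⟨k, m, b, θ, hnm, hθ, rfl⟩, t, by simp [t], ?_, ?_⟩
        · rw [← hφ', ht]
          exact hθφ a ha
        · rw [Formula.realize_relabel, ht]
          exact ha)
  have hmeet : L.MeetsDefinable (Set.range (s ∘ Sum.inr)) := by
    refine meetsDefinable_range s Sum.inr fun ψ hψ => ?_
    obtain ⟨χ, rfl | ⟨d, rfl⟩, hχ⟩ := hDs (Sum.inl ψ)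
    · exact absurd (Formula.realize_iExs.2 hψ) (Formula.realize_not.1 hχ)
    · refine ⟨d, ?_⟩
      rw [Formula.realize_relabel] at hχ
      convert hχ using 1
      funext i
      rcases i with i | i <;> rfl
  let S := hmeet.toElementarySubstructure
  have hS : ∀ x, x ∈ S ↔ ∃ i : ℕ, s (Sum.inr i) = x := by
    intro x
    change x ∈ (Substructure.closure L (Set.range (s ∘ Sum.inr)) : Set N) ↔ _
    rw [hmeet.closure_eq_self]
    rfl
  have hBS : ∀ b : B, s (Sum.inl b) ∈ S := by
    intro b
    rw [hS]
    obtain ⟨χ, rfl | ⟨d, rfl⟩, hχ⟩ := hDs (Sum.inl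
      ((Term.var (Sum.inr 0)).equal (Term.var (Sum.inl (Sum.inl b)))))
    · exact absurd ⟨fun _ => s (Sum.inl b), by simp [Formula.realize_equal]⟩
        (Formula.realize_iExs.not.1 (Formula.realize_not.1 hχ))
    · exact ⟨d, by simpa [Formula.realize_equal] using hχ⟩
  have hsB : ∀ (n : ℕ) (φ : L.Formula (Fin n)) (b : Fin n → B),
      φ.Realize (fun i => (b i : M)) → φ.Realize (fun i => s (Sum.inl (b i))) := by
    intro n φ b h
    have := hVs (φ.relabel (Sum.inl ∘ b)) (fun v hv => by
      rw [Formula.realize_relabel]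
      convert h using 1
      funext i
      exact congrFun hv (b i))
    rw [Formula.realize_relabel] at this
    exact this
  have he : PartialElem L B (fun b => (⟨s (Sum.inl b), hBS b⟩ : S)) := by
    intro n φ b
    rw [← S.subtype.map_formula]
    refine ⟨hsB n φ b, fun h => ?_⟩
    by_contra hn
    exact hsB n (∼φ) b hn h
  refine ⟨S.toModel (L.completeTheory M), fun b => (⟨s (Sum.inl b), hBS b⟩ : S), ?_, he, ?_⟩
  · have : Function.Surjective (fun i : ℕ => (⟨s (Sum.inr i), (hS _).2 ⟨i, rfl⟩⟩ : S)) := by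
      rintro ⟨x, hx⟩
      obtain ⟨i, rfl⟩ := (hS x).1 hx
      exact ⟨i, rfl⟩
    exact this.countable
  · intro n (a : Fin n → S)
    choose i hi using fun j => (hS (a j)).1 (a j).2
    obtain ⟨n', hn'⟩ := (Set.finite_range i).bddAbove
    obtain ⟨χ, ⟨k, m, b, θ, hm, hθ, rfl⟩, hχ⟩ := hDs (Sum.inr (n' + 1))
    have him : ∀ j, i j < m := fun j => by
      have := hn' ⟨j, rfl⟩
      omega
    have hprin := (hθ.map he).isPrincipalT_comp
      (a := fun j : Fin m => (⟨s (Sum.inr j), (hS _).2 ⟨j, rfl⟩⟩ : S)) (by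
        rw [← S.subtype.map_formula]
        rw [Formula.realize_relabel] at hχ
        convert hχ using 1
        funext j
        rcases j with j | j <;> rfl) (fun j : Fin n => (⟨i j, him j⟩ : Fin m))
    refine ⟨k, b, ?_⟩
    have ha : a = fun j => (⟨s (Sum.inr (i j)), (hS _).2 ⟨i j, rfl⟩⟩ : S) :=
      funext fun j => Subtype.ext (hi j).symm
    rw [ha]
    exact hprin

end LocallyAtomic

/-- Theorem 2. For every countable subset `B` of a model `M` of a small
countable complete theory `T = Th(M)` there is a countable model `A ⊨ T` containing `B`
(via the partial elementary identification `e`) such that (1) every finite tuple of `A`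
has a principal type over some finite tuple from `B`, (2) the finite diagram of `A` is
contained in the finite diagram of every model `C ⊨ T` containing `B`, and consequently
(3) any two such countable models have the same finite diagram. -/
theorem statement_1 {L : FirstOrder.Language.{u, v}} (hL : Countable L.Symbols)
    {M : Type w} [L.Structure M] [Nonempty M]
    (hsmall : IsSmall L (L.completeTheory M))
    (B : Set M) (hB : B.Countable) :
    ∃ (A : Theory.ModelType.{u, v, max u v w} (L.completeTheory M)) (e : B → A),
      Countable A ∧ PartialElem L B e ∧
      (∀ (n : ℕ) (a : Fin n → A), ∃ (k : ℕ) (bb : Fin k → B),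
        IsPrincipalT L (fun i => e (bb i)) a) ∧
      (∀ (C : Theory.ModelType.{u, v, max u v w} (L.completeTheory M)) (g : B → C),
        PartialElem L B g → FinDiagSubset L A C) ∧
      ∀ (A' : Theory.ModelType.{u, v, max u v w} (L.completeTheory M)) (e' : B → A'),
        Countable A' → PartialElem L B e' →
        (∀ (n : ℕ) (a : Fin n → A'), ∃ (k : ℕ) (bb : Fin k → B),
          IsPrincipalT L (fun i => e' (bb i)) a) →
        (∀ (C : Theory.ModelType.{u, v, max u v w} (L.completeTheory M)) (g : B → C),
          PartialElem L B g → FinDiagSubset L A' C) →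
        (FinDiagSubset L A A' ∧ FinDiagSubset L A' A) := by
  obtain ⟨A, e, hA, he, hprin⟩ := hsmall.exists_locallyAtomic hL B hB
  exact ⟨A, e, hA, he, hprin, fun C g hg => finDiagSubset_of_isPrincipalT he hg hprin,
    fun A' e' _ he' hprin' _ => ⟨finDiagSubset_of_isPrincipalT he he' hprin,
      finDiagSubset_of_isPrincipalT he' he hprin'⟩⟩

end Paper
end

section
/- Let T be a countable complete linearly ordered theory. If there exists a finite subset A of a model M ⊨ T and a non-principal extremely trivial type p(x) ∈ S_1(A), then T has 2^{ℵ_0} pairwise non-isomorphic countable models. -/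
namespace Paper

open FirstOrder FirstOrder.Language Set

universe u v w x y

variable (L : FirstOrder.Language.{u, v})

section Saturation

variable {L} {M : Type w} [L.Structure M]

theorem exists_finset_support {α : Type*} (φ : L.Formula α) :
    ∃ (s : Finset α) (ψ : L.Formula s),
      ∀ v : α → M, φ.Realize v ↔ ψ.Realize fun i => v i := by
  classical
  refine ⟨φ.freeVarFinset, φ.restrictFreeVar id, fun v => ?_⟩
  exact (BoundedFormula.realize_restrictFreeVar (φ := φ) (f := id) (v := fun i => v i) v
    fun _ => rfl).symm

theorem exists_formula_exists [Nonempty M] {α β : Type*} (φ : L.Formula (α ⊕ β)) :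
    ∃ ψ : L.Formula α,
      ∀ u : α → M, ψ.Realize u ↔ ∃ w : β → M, φ.Realize (Sum.elim u w) := by
  classical
  obtain ⟨s, χ, hχ⟩ := exists_finset_support (M := M) φ
  let g : s → α ⊕ s.toRight := fun i => match i with
    | ⟨.inl a, _⟩ => .inl a
    | ⟨.inr b, h⟩ => .inr ⟨b, Finset.mem_toRight.2 h⟩
  refine ⟨(χ.relabel g).iExs s.toRight, fun u => ?_⟩
  have hg : ∀ w : β → M, Sum.elim u (fun b : s.toRight => w b) ∘ g =
      fun i : s => Sum.elim u w i := by
    intro w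
    funext ⟨i, hi⟩
    rcases i with a | b <;> rfl
  rw [Formula.realize_iExs]
  constructor
  · rintro ⟨i, hi⟩
    let w : β → M := fun b => if h : b ∈ s.toRight then i ⟨b, h⟩ else Classical.arbitrary M
    have hw : i = fun b : s.toRight => w b := by
      funext ⟨b, hb⟩
      simp only [w, dif_pos hb]
    refine ⟨w, ?_⟩
    rw [hw, Formula.realize_relabel, hg] at hi
    exact (hχ _).2 hi
  · rintro ⟨w, hw⟩
    refine ⟨fun b => w b, ?_⟩
    rw [Formula.realize_relabel, hg]
    exact (hχ _).1 hw

theorem OmegaSaturated.exists_extend (hM : OmegaSaturated L M) (G : Filter (ℕ → M)) {n : ℕ}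
    {v : ℕ → M}
    (h : ∀ φ : L.Formula (Fin n), (∀ᶠ w in G, φ.Realize fun i => w i) → φ.Realize fun i => v i) :
    ∃ x, ∀ φ : L.Formula (Fin (n + 1)), (∀ᶠ w in G, φ.Realize fun i => w i) →
      φ.Realize fun i => Function.update v n x i := by
  obtain ⟨x, hx⟩ := hM n (fun i => v i)
    {φ | ∀ᶠ w in G, φ.Realize (Sum.elim (fun i => w i) fun _ => w n)} (by
      intro S₀ hS₀
      have := h (Formula.iExs (Fin 1) (Formula.iInf fun φ : S₀ => φ.1)) (by
        have h' : ∀ᶠ w in G, ∀ φ : S₀, φ.1.Realize (Sum.elim (fun i => w i) fun _ => w n) :=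
          Filter.eventually_all.2 fun φ => hS₀ φ.2
        filter_upwards [h'] with w hw
        rw [Formula.realize_iExs]
        exact ⟨fun _ => w n, by simpa using hw⟩)
      rw [Formula.realize_iExs] at this
      obtain ⟨i, hi⟩ := this
      refine ⟨i 0, fun φ hφ => ?_⟩
      have := (BoundedFormula.realize_iInf.1 hi) ⟨φ, hφ⟩
      have hi' : i = fun _ => i 0 := funext fun j => by rw [Subsingleton.elim j 0]
      rw [hi'] at this
      exact this)
  have key : ∀ w : ℕ → M, (Sum.elim (fun i : Fin n => w i) fun _ : Fin 1 => w n) ∘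
      finSumFinEquiv.symm = fun i : Fin (n + 1) => w i := by
    intro w
    funext i
    refine Fin.addCases (fun j => ?_) (fun j => ?_) i
    · simp
    · simp
  refine ⟨x, fun φ hφ => ?_⟩
  have := hx (φ.relabel finSumFinEquiv.symm) (by
    filter_upwards [hφ] with w hw
    rwa [Formula.realize_relabel, key])
  rw [Formula.realize_relabel] at this
  have hv : (Sum.elim (fun i : Fin n => v i) fun _ : Fin 1 => x) =
      Sum.elim (fun i : Fin n => Function.update v n x i)
        fun _ : Fin 1 => Function.update v n x n := by
    funext i
    rcases i with i | i
    · simp [Function.update_of_ne i.2.ne]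
    · simp
  rwa [hv, key] at this

/-- In an ω-saturated structure, a filter of sequences with a fixed initial segment has a limit
with the same initial segment. -/
theorem OmegaSaturated.exists_limit_nat (hM : OmegaSaturated L M) (G : Filter (ℕ → M)) [G.NeBot]
    (r : ℕ) (e : ℕ → M) (he : ∀ᶠ w in G, ∀ i < r, w i = e i) :
    ∃ v : ℕ → M, (∀ i < r, v i = e i) ∧
      ∀ φ : L.Formula ℕ, (∀ᶠ w in G, φ.Realize w) → φ.Realize v := by
  let P : ℕ → (ℕ → M) → Prop := fun n v =>
    ∀ φ : L.Formula (Fin n), (∀ᶠ w in G, φ.Realize fun i => w i) → φ.Realize fun i => v i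
  have h0 : P r e := by
    intro φ hφ
    obtain ⟨w, hw, hw'⟩ := (hφ.and he).exists
    convert hw using 2
    exact (hw' _ (Fin.is_lt _)).symm
  have step : ∀ n (v : {v // P n v}), ∃ x, P (n + 1) (Function.update v.1 n x) :=
    fun n v => hM.exists_extend G v.2
  choose x hx using step
  let s : ∀ n, {v // P (r + n) v} := fun n =>
    Nat.rec ⟨e, h0⟩ (fun n v => ⟨_, hx (r + n) v⟩) n
  have hs : ∀ n, (s (n + 1)).1 = Function.update (s n).1 (r + n) (x (r + n) (s n)) :=
    fun n => rfl
  have stable : ∀ n m i, i < r + n → (s (n + m)).1 i = (s n).1 i := by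
    intro n m i hi
    induction m with
    | zero => rfl
    | succ m ih =>
      change (s (n + m + 1)).1 i = _
      rw [hs, Function.update_of_ne (by omega), ih]
  have agree : ∀ n i, i < r + n → (s (i + 1)).1 i = (s n).1 i := by
    intro n i hi
    rcases le_total (i + 1) n with h | h
    · obtain ⟨m, rfl⟩ := Nat.exists_eq_add_of_le h
      exact (stable _ _ _ (by omega)).symm
    · obtain ⟨m, hm⟩ := Nat.exists_eq_add_of_le h
      rw [hm]
      exact stable _ _ _ hi
  refine ⟨fun i => (s (i + 1)).1 i, fun i hi => agree 0 i (by omega), fun φ hφ => ?_⟩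
  obtain ⟨t, χ, hχ⟩ := exists_finset_support (M := M) φ
  obtain ⟨n, hn⟩ : ∃ n, ∀ i ∈ t, i < r + n :=
    ⟨t.sup id + 1, fun i hi => by have := Finset.le_sup (f := id) hi; simp at this; omega⟩
  have := (s n).2 (χ.relabel fun i : t => (⟨i, hn i i.2⟩ : Fin (r + n))) (by
    filter_upwards [hφ] with w hw
    rw [Formula.realize_relabel]
    exact (hχ w).1 hw)
  rw [Formula.realize_relabel] at this
  rw [hχ]
  convert this using 2 with i
  exact agree n i (hn i i.2)

/-- In an ω-saturated structure, a filter of countable tuples has a limit over finitely many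
parameters. -/
theorem OmegaSaturated.exists_limit (hM : OmegaSaturated L M) [Nonempty M] {r : ℕ} (e : Fin r → M)
    {ι : Type*} [Countable ι] (F : Filter (ι → M)) [F.NeBot] :
    ∃ v : ι → M, ∀ φ : L.Formula (Fin r ⊕ ι),
      (∀ᶠ w in F, φ.Realize (Sum.elim e w)) → φ.Realize (Sum.elim e v) := by
  obtain ⟨f, hf⟩ := exists_injective_nat ι
  let d : M := Classical.arbitrary M
  let W : (ι → M) → ℕ → M := fun w i =>
    if h : i < r then e ⟨i, h⟩ else Function.extend f w (fun _ => d) (i - r)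
  let g : Fin r ⊕ ι → ℕ := Sum.elim Fin.val fun i => r + f i
  have hW : ∀ w, W w ∘ g = Sum.elim e w := by
    intro w
    funext i
    rcases i with i | i
    · simp [W, g]
    · simp [W, g, hf.extend_apply]
  obtain ⟨v, hv, hv'⟩ := hM.exists_limit_nat (F.map W) r (W fun _ => d)
    (Filter.eventually_map.2 (Filter.Eventually.of_forall fun w i hi => by simp [W, hi]))
  refine ⟨fun i => v (r + f i), fun φ hφ => ?_⟩
  have := hv' (φ.relabel g) (Filter.eventually_map.2 (by
    filter_upwards [hφ] with w hw
    rwa [Formula.realize_relabel, hW]))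
  rw [Formula.realize_relabel] at this
  convert this using 1
  funext i
  rcases i with i | i
  · simp [g, hv _ i.2, W]
  · rfl

end Saturation


section Generic

variable {L} {M : Type w} [L.Structure M]

theorem tpT_eq_of_subset {β γ : Type*} {c : β → M} {a : γ → M} {c' : β → M} {a' : γ → M}
    (h : tpT L c a ⊆ tpT L c' a') : tpT L c a = tpT L c' a' := by
  refine h.antisymm fun φ hφ => ?_
  by_contra hn
  exact h (show φ.not ∈ tpT L c a from Formula.realize_not.2 hn) hφ

/-- A Baire category theorem for types: countably many dense conditions on tuples from `V` can be
met simultaneously by a limit of tuples from `V`. -/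
theorem OmegaSaturated.exists_generic (hM : OmegaSaturated L M) [Nonempty M] {r : ℕ}
    (e : Fin r → M) {ι : Type*} [Countable ι] (V : Set (ι → M)) (hV : V.Nonempty)
    {J : Type*} [Countable J] (D : J → Set (L.Formula (Fin r ⊕ ι)))
    (hD : ∀ j (φ : L.Formula (Fin r ⊕ ι)), ∀ v ∈ V, φ.Realize (Sum.elim e v) →
      ∃ v' ∈ V, φ.Realize (Sum.elim e v') ∧ ∃ ψ ∈ D j, ψ.Realize (Sum.elim e v')) :
    ∃ v, (∀ j, ∃ ψ ∈ D j, ψ.Realize (Sum.elim e v)) ∧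
      ∀ φ : L.Formula (Fin r ⊕ ι), (∀ v ∈ V, φ.Realize (Sum.elim e v)) →
        φ.Realize (Sum.elim e v) := by
  obtain ⟨enc, henc⟩ := exists_injective_nat J
  let Q := {φ : L.Formula (Fin r ⊕ ι) // ∃ v ∈ V, φ.Realize (Sum.elim e v)}
  have step : ∀ (n : ℕ) (φ : Q), ∃ φ' : Q,
      (∀ w : ι → M, φ'.1.Realize (Sum.elim e w) → φ.1.Realize (Sum.elim e w)) ∧
      ∀ j, enc j = n → ∃ ψ ∈ D j, ∀ w : ι → M, φ'.1.Realize (Sum.elim e w) →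
        ψ.Realize (Sum.elim e w) := by
    rintro n ⟨φ, v, hv, hφ⟩
    by_cases hn : ∃ j, enc j = n
    · obtain ⟨j, rfl⟩ := hn
      obtain ⟨v', hv', h1, ψ, hψ, h2⟩ := hD j φ v hv hφ
      refine ⟨⟨φ ⊓ ψ, v', hv', Formula.realize_inf.2 ⟨h1, h2⟩⟩,
        fun w hw => (Formula.realize_inf.1 hw).1, fun i hi => ?_⟩
      obtain rfl := henc hi
      exact ⟨ψ, hψ, fun w hw => (Formula.realize_inf.1 hw).2⟩
    · exact ⟨⟨φ, v, hv, hφ⟩, fun w hw => hw, fun j hj => (hn ⟨j, hj⟩).elim⟩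
  choose next hnext hnext' using step
  obtain ⟨v₀, hv₀⟩ := hV
  let s : ℕ → Q := fun n => Nat.rec ⟨⊤, v₀, hv₀, Formula.realize_top.2 trivial⟩ next n
  have hs : ∀ n, s (n + 1) = next n (s n) := fun n => rfl
  have anti : ∀ m n, m ≤ n → ∀ w : ι → M, (s n).1.Realize (Sum.elim e w) →
      (s m).1.Realize (Sum.elim e w) := by
    intro m n h
    induction n, h using Nat.le_induction with
    | base => exact fun w hw => hw
    | succ n _ ih => exact fun w hw => ih w (hnext n (s n) w hw)
  choose a haV ha using fun n => (s n).2
  obtain ⟨v, hv⟩ := hM.exists_limit e (Filter.map a Filter.atTop)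
  refine ⟨v, fun j => ?_, fun φ hφ => hv φ
    (Filter.eventually_map.2 (Filter.Eventually.of_forall fun n => hφ _ (haV n)))⟩
  obtain ⟨ψ, hψ, hψ'⟩ := hnext' _ (s (enc j)) j rfl
  refine ⟨ψ, hψ, hv ψ (Filter.eventually_map.2 ?_)⟩
  filter_upwards [Filter.eventually_ge_atTop (enc j + 1)] with n hn
  exact hψ' _ (anti _ _ hn _ (ha n))

theorem exists_elementarySubstructure_of_range (a : ℕ → M)
    (h : ∀ (φ : L.Formula (ℕ ⊕ Fin 1)) (x : M), φ.Realize (Sum.elim a fun _ => x) →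
      ∃ i, φ.Realize (Sum.elim a fun _ => a i)) :
    ∃ N : L.ElementarySubstructure M, ∀ x, x ∈ N ↔ x ∈ range a := by
  have hA : L.MeetsDefinable (range a) := by
    rintro D ⟨x, hx⟩ hD
    obtain ⟨φ, hφ⟩ := definable_iff_exists_formula_sum.1 hD
    have key : ∀ y, y ∈ D ↔
        φ.Realize (Sum.elim (fun z : range a => (z : M)) fun _ : Fin 1 => y) :=
      fun y => Set.ext_iff.1 hφ fun _ => y
    choose idx hidx using fun z : range a => z.2
    let g : range a ⊕ Fin 1 → ℕ ⊕ Fin 1 := Sum.map idx id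
    have hg : ∀ y, (Sum.elim a fun _ : Fin 1 => y) ∘ g =
        Sum.elim (fun z : range a => (z : M)) fun _ : Fin 1 => y := by
      intro y
      funext i
      rcases i with i | i
      · exact hidx i
      · rfl
    obtain ⟨i, hi⟩ := h (φ.relabel g) x (by rw [Formula.realize_relabel, hg]; exact (key x).1 hx)
    rw [Formula.realize_relabel, hg] at hi
    exact ⟨a i, (key _).2 hi, i, rfl⟩
  exact ⟨hA.toElementarySubstructure, fun x => Set.ext_iff.1 hA.closure_eq_self x⟩

/-- Countably many dense conditions on sequences over a base tuple `b₀` are met by an enumeration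
of an elementary substructure containing a tuple with the type of `b₀`. -/
theorem OmegaSaturated.exists_generic_model (hM : OmegaSaturated L M) [Nonempty M]
    [Countable L.Symbols] {r : ℕ} (e : Fin r → M) {κ : Type*} [Countable κ] (b₀ : κ → M)
    {J : Type*} [Countable J] (D : J → Set (L.Formula (Fin r ⊕ (κ ⊕ ℕ))))
    (hD : ∀ j (φ : L.Formula (Fin r ⊕ (κ ⊕ ℕ))) (a : ℕ → M), φ.Realize (Sum.elim e (Sum.elim b₀ a)) →
      ∃ a' : ℕ → M, φ.Realize (Sum.elim e (Sum.elim b₀ a')) ∧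
        ∃ ψ ∈ D j, ψ.Realize (Sum.elim e (Sum.elim b₀ a'))) :
    ∃ (b : κ → M) (a : ℕ → M), tpT L e b₀ = tpT L e b ∧
      (∀ j, ∃ ψ ∈ D j, ψ.Realize (Sum.elim e (Sum.elim b a))) ∧
      ∃ N : L.ElementarySubstructure M, (∀ x, x ∈ N ↔ x ∈ range a) ∧
        (∀ i, e i ∈ N) ∧ ∀ i, b i ∈ N := by
  classical
  let w (φ : L.Formula ((Fin r ⊕ (κ ⊕ ℕ)) ⊕ Fin 1)) (i : ℕ) : L.Formula (Fin r ⊕ (κ ⊕ ℕ)) :=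
    φ.relabel (Sum.elim id fun _ => .inr (.inr i))
  have hw : ∀ φ i (v : κ ⊕ ℕ → M), (w φ i).Realize (Sum.elim e v) ↔
      φ.Realize (Sum.elim (Sum.elim e v) fun _ => v (.inr i)) := by
    intro φ i v
    rw [Formula.realize_relabel]
    refine iff_of_eq (congrArg _ ?_)
    funext j
    rcases j with j | j <;> rfl
  let D' : J ⊕ L.Formula ((Fin r ⊕ (κ ⊕ ℕ)) ⊕ Fin 1) → Set (L.Formula (Fin r ⊕ (κ ⊕ ℕ))) :=
    Sum.elim D fun φ => {ψ | ψ = (φ.iExs (Fin 1)).not ∨ ∃ i, ψ = w φ i}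
  obtain ⟨v, hv, hvV⟩ := hM.exists_generic e (range fun a : ℕ → M => Sum.elim b₀ a)
    ⟨_, fun _ => Classical.arbitrary M, rfl⟩ D' (by
      rintro (j | φ) χ _ ⟨a, rfl⟩ hχ
      · obtain ⟨a', h1, h2⟩ := hD j χ a hχ
        exact ⟨_, ⟨a', rfl⟩, h1, h2⟩
      · by_cases hφ : (φ.iExs (Fin 1)).Realize (Sum.elim e (Sum.elim b₀ a))
        · obtain ⟨x, hx⟩ := (Formula.realize_iExs).1 hφ
          obtain ⟨s, χ', hχ'⟩ := exists_finset_support (M := M) χ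
          obtain ⟨t, φ', hφ'⟩ := exists_finset_support (M := M) φ
          obtain ⟨i, hi⟩ := Infinite.exists_notMem_finset
            (s.toRight.toRight ∪ t.toLeft.toRight.toRight)
          simp only [Finset.mem_union, Finset.mem_toRight, Finset.mem_toLeft, not_or] at hi
          refine ⟨_, ⟨Function.update a i (x 0), rfl⟩, ?_, w φ i, Or.inr ⟨i, rfl⟩, ?_⟩
          · rw [hχ'] at hχ ⊢
            convert hχ using 2 with y
            obtain ⟨y | y | y, hy⟩ := y
            · rfl
            · rfl
            · exact Function.update_of_ne (by rintro rfl; exact hi.1 hy) _ _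
          · rw [hw]
            rw [hφ'] at hx ⊢
            convert hx using 2 with y
            obtain ⟨(y | y | y) | y, hy⟩ := y
            · rfl
            · rfl
            · exact Function.update_of_ne (by rintro rfl; exact hi.2 hy) _ _
            · obtain rfl := Subsingleton.elim y 0
              exact Function.update_self ..
        · exact ⟨_, ⟨a, rfl⟩, hχ, _, Or.inl rfl, Formula.realize_not.2 hφ⟩)
  obtain ⟨b, a, rfl⟩ : ∃ b a, v = Sum.elim b a :=
    ⟨v ∘ Sum.inl, v ∘ Sum.inr, (Sum.elim_comp_inl_inr v).symm⟩
  have wit : ∀ (φ : L.Formula ((Fin r ⊕ (κ ⊕ ℕ)) ⊕ Fin 1)) (x : M),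
      φ.Realize (Sum.elim (Sum.elim e (Sum.elim b a)) fun _ => x) →
      ∃ i, φ.Realize (Sum.elim (Sum.elim e (Sum.elim b a)) fun _ => a i) := by
    intro φ x hx
    obtain ⟨ψ, rfl | ⟨i, rfl⟩, hψ⟩ := hv (.inr φ)
    · exact (Formula.realize_not.1 hψ (Formula.realize_iExs.2 ⟨_, hx⟩)).elim
    · exact ⟨i, (hw _ _ _).1 hψ⟩
  obtain ⟨N, hN⟩ := exists_elementarySubstructure_of_range (L := L) a (by
    intro φ x hx
    let g : ℕ ⊕ Fin 1 → (Fin r ⊕ (κ ⊕ ℕ)) ⊕ Fin 1 := Sum.map (fun i => .inr (.inr i)) id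
    have hg : ∀ y, (Sum.elim (Sum.elim e (Sum.elim b a)) fun _ : Fin 1 => y) ∘ g =
        Sum.elim a fun _ => y := by
      intro y
      funext i
      rcases i with i | i <;> rfl
    obtain ⟨i, hi⟩ := wit (φ.relabel g) x (by rwa [Formula.realize_relabel, hg])
    rw [Formula.realize_relabel, hg] at hi
    exact ⟨i, hi⟩)
  have mem : ∀ j, Sum.elim e (Sum.elim b a) j ∈ N := by
    intro j
    obtain ⟨i, hi⟩ := wit (Term.equal (.var (.inr 0)) (.var (.inl j)))
      (Sum.elim e (Sum.elim b a) j) (by simp [Formula.realize_equal])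
    rw [Formula.realize_equal] at hi
    exact (hN _).2 ⟨i, hi⟩
  refine ⟨b, a, tpT_eq_of_subset fun φ hφ => ?_, fun j => hv (.inl j), N, hN,
    fun i => mem (.inl i), fun i => mem (.inr (.inl i))⟩
  have hg : ∀ (b' : κ → M) (a' : ℕ → M),
      Sum.elim e (Sum.elim b' a') ∘ Sum.map id Sum.inl = Sum.elim e b' := by
    intro b' a'
    funext i
    rcases i with i | i <;> rfl
  have := hvV (φ.relabel (Sum.map id Sum.inl)) (by
    rintro _ ⟨a', rfl⟩
    rw [Formula.realize_relabel, hg]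
    exact hφ)
  rw [Formula.realize_relabel, hg] at this
  exact this

end Generic


section Prime

variable {L} {M : Type w} [L.Structure M]

/-- `θ` isolates a complete type over `e`, or is inconsistent. -/
def Isolates {β γ : Type*} (e : β → M) (θ : L.Formula (β ⊕ γ)) : Prop :=
  ∀ a a' : γ → M, θ.Realize (Sum.elim e a) → θ.Realize (Sum.elim e a') → tpT L e a = tpT L e a'

theorem tpT_comp {β γ δ : Type*} {e : β → M} {a a' : γ → M} (h : tpT L e a = tpT L e a')
    (f : δ → γ) : tpT L e (a ∘ f) = tpT L e (a' ∘ f) := by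
  refine tpT_eq_of_subset fun φ hφ => ?_
  have key : ∀ b : γ → M, Sum.elim e b ∘ Sum.map id f = Sum.elim e (b ∘ f) := by
    intro b
    funext i
    rcases i with i | i <;> rfl
  have h1 : φ.relabel (Sum.map id f) ∈ tpT L e a := by
    change Formula.Realize _ _
    rw [Formula.realize_relabel, key]
    exact hφ
  rw [h] at h1
  change Formula.Realize _ _ at h1
  rw [Formula.realize_relabel, key] at h1
  exact h1

theorem countable_range_tpT {r m : ℕ}
    (hs : (range fun v : Fin (r + m) → M => tp0 L v).Countable) (e : Fin r → M) :
    (range fun a : Fin m → M => tpT L e a).Countable := by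
  refine (hs.image fun t => {φ | φ.relabel finSumFinEquiv ∈ t}).mono ?_
  rintro _ ⟨a, rfl⟩
  refine ⟨_, ⟨Sum.elim e a ∘ finSumFinEquiv.symm, rfl⟩, ?_⟩
  ext φ
  change (φ.relabel finSumFinEquiv).Realize (Sum.elim e a ∘ finSumFinEquiv.symm) ↔ _
  rw [Formula.realize_relabel]
  simp [Function.comp_assoc, tpT]

/-- If there are only countably many types, then isolated types are dense. -/
theorem OmegaSaturated.exists_isolates (hM : OmegaSaturated L M) [Nonempty M]
    {r m : ℕ} (hs : (range fun v : Fin (r + m) → M => tp0 L v).Countable)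
    (e : Fin r → M) (χ : L.Formula (Fin r ⊕ Fin m)) (a : Fin m → M)
    (ha : χ.Realize (Sum.elim e a)) :
    ∃ (a' : Fin m → M) (θ : L.Formula (Fin r ⊕ Fin m)), χ.Realize (Sum.elim e a') ∧
      θ.Realize (Sum.elim e a') ∧ Isolates e θ := by
  by_contra! hcon
  have := (countable_range_tpT hs e).to_subtype
  obtain ⟨v, hv, hvV⟩ := hM.exists_generic e {a | χ.Realize (Sum.elim e a)} ⟨a, ha⟩
    (fun t : range fun a : Fin m → M => tpT L e a => {ψ | ψ ∉ t.1}) (by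
      rintro ⟨_, t, rfl⟩ φ v hv hφ
      have : ∃ b, tpT L e b ≠ tpT L e t ∧ (χ ⊓ φ).Realize (Sum.elim e b) := by
        have h := hcon v (χ ⊓ φ) hv (Formula.realize_inf.2 ⟨hv, hφ⟩)
        simp only [Isolates, not_forall] at h
        obtain ⟨b, b', hb, hb', hne⟩ := h
        by_cases hbt : tpT L e b = tpT L e t
        · exact ⟨b', fun h => hne (hbt.trans h.symm), hb'⟩
        · exact ⟨b, hbt, hb⟩
      obtain ⟨b, hbt, hb⟩ := this
      obtain ⟨ψ, h1, h2⟩ := Set.not_subset.1 fun h => hbt (tpT_eq_of_subset h)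
      exact ⟨b, (Formula.realize_inf.1 hb).1, (Formula.realize_inf.1 hb).2, ψ, h2, h1⟩)
  obtain ⟨ψ, h1, h2⟩ := hv ⟨_, v, rfl⟩
  exact h1 h2

theorem Isolates.isPrincipalT_comp {r m n : ℕ} {e : Fin r → M} {θ : L.Formula (Fin r ⊕ Fin m)}
    (hθ : Isolates e θ) {a : Fin m → M} (ha : θ.Realize (Sum.elim e a)) (f : Fin n → Fin m) :
    IsPrincipalT L e (a ∘ f) := by
  let η : L.Formula ((Fin r ⊕ Fin n) ⊕ Fin m) :=
    θ.relabel (Sum.map Sum.inl id) ⊓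
      Formula.iInf fun j => Term.equal (.var (.inl (.inr j))) (.var (.inr (f j)))
  have hη : ∀ (y : Fin n → M) (z : Fin m → M), η.Realize (Sum.elim (Sum.elim e y) z) ↔
      θ.Realize (Sum.elim e z) ∧ y = z ∘ f := by
    intro y z
    have : Sum.elim (Sum.elim e y) z ∘ Sum.map Sum.inl id = Sum.elim e z := by
      funext i
      rcases i with i | i <;> rfl
    simp only [η, Formula.realize_inf, Formula.realize_relabel, this, funext_iff]
    refine and_congr_right fun _ => ?_
    refine BoundedFormula.realize_iInf.trans (forall_congr' fun j => ?_)
    exact Formula.realize_equal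
  refine ⟨η.iExs (Fin m), Formula.realize_iExs.2 ⟨a, (hη _ _).2 ⟨ha, rfl⟩⟩, fun y hy => ?_⟩
  obtain ⟨z, hz⟩ := Formula.realize_iExs.1 hy
  obtain ⟨hz', rfl⟩ := (hη _ _).1 hz
  exact tpT_comp (hθ _ _ hz' ha) f

theorem OmegaSaturated.exists_isPrimeOver [LinearOrder M] (hM : OmegaSaturated L M) [Nonempty M]
    [Countable L.Symbols] (hs : ∀ n, (range fun v : Fin n → M => tp0 L v).Countable) {r : ℕ}
    (e : Fin r → M) : ∃ N : L.ElementarySubstructure M, IsPrimeOver L N e := by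
  let g (m : ℕ) : Fin r ⊕ Fin m → Fin r ⊕ (Empty ⊕ ℕ) := Sum.map id fun i => .inr i
  have hg : ∀ m (b : Empty → M) (a : ℕ → M),
      Sum.elim e (Sum.elim b a) ∘ g m = Sum.elim e fun i : Fin m => a i := by
    intro m b a
    funext i
    rcases i with i | i <;> rfl
  obtain ⟨b, a, -, ha, N, hN, heN, -⟩ := hM.exists_generic_model e Empty.elim
    (fun m : ℕ => {ψ | ∃ θ : L.Formula (Fin r ⊕ Fin m), Isolates e θ ∧ ψ = θ.relabel (g m)}) (by
      intro m φ a hφ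
      let h : Fin r ⊕ (Empty ⊕ ℕ) → (Fin r ⊕ Fin m) ⊕ ℕ :=
        Sum.elim (fun i => .inl (.inl i)) (Sum.elim Empty.elim fun i =>
          if hi : i < m then .inl (.inr ⟨i, hi⟩) else .inr i)
      have hh : ∀ (u : Fin m → M) (w : ℕ → M), Sum.elim (Sum.elim e u) w ∘ h =
          Sum.elim e (Sum.elim Empty.elim fun i => if hi : i < m then u ⟨i, hi⟩ else w i) := by
        intro u w
        funext i
        rcases i with i | i | i
        · rfl
        · exact i.elim
        · by_cases hi : i < m <;> simp [h, hi]
      obtain ⟨χ, hχ⟩ := exists_formula_exists (M := M) (φ.relabel h)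
      have hχ' : ∀ u : Fin m → M, χ.Realize (Sum.elim e u) ↔ ∃ w : ℕ → M, φ.Realize
          (Sum.elim e (Sum.elim Empty.elim fun i => if hi : i < m then u ⟨i, hi⟩ else w i)) := by
        intro u
        rw [hχ]
        simp only [Formula.realize_relabel, hh]
      obtain ⟨u, θ, hu, hθu, hθ⟩ := hM.exists_isolates (hs _) e χ (fun i => a i)
        ((hχ' _).2 ⟨a, by simpa using hφ⟩)
      obtain ⟨w, hw⟩ := (hχ' u).1 hu
      refine ⟨_, hw, _, ⟨θ, hθ, rfl⟩, ?_⟩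
      rw [Formula.realize_relabel, hg]
      simpa using hθu)
  refine ⟨N, heN, ?_, fun n x => ?_⟩
  · refine ((Set.countable_range a).mono fun x hx => (hN x).1 hx).to_subtype
  · choose idx hidx using fun i => (hN (x i)).1 (x i).2
    obtain ⟨m, hm⟩ : ∃ m, ∀ i, idx i < m :=
      ⟨Finset.univ.sup idx + 1, fun i => Nat.lt_succ_of_le (Finset.le_sup (Finset.mem_univ i))⟩
    obtain ⟨_, ⟨θ, hθ, rfl⟩, hθa⟩ := ha m
    rw [Formula.realize_relabel, hg] at hθa
    have := hθ.isPrincipalT_comp hθa fun i => ⟨idx i, hm i⟩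
    have hx : (fun i => (x i : M)) = (fun i : Fin m => a i) ∘ fun i => ⟨idx i, hm i⟩ :=
      funext fun i => (hidx i).symm
    rwa [hx]

theorem OmegaSaturated.exists_model_pSet_eq_range [LinearOrder M] (hM : OmegaSaturated L M)
    [Nonempty M] [Countable L.Symbols]
    (hs : ∀ n, (range fun v : Fin n → M => tp0 L v).Countable) {k : ℕ} {c : Fin k → M} {a₀ : M}
    (htriv : ExtremelyTrivial L c a₀) {κ : Type*} [Countable κ] [Nonempty κ] (b₀ : κ → M)
    (hb₀ : ∀ i, b₀ i ∈ pSet L c a₀) :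
    ∃ (b : κ → M) (N : L.ElementarySubstructure M), tpT L c b₀ = tpT L c b ∧ Countable N ∧
      (∀ i, c i ∈ N) ∧ (∀ i, b i ∈ N) ∧ ∀ x ∈ N, x ∈ pSet L c a₀ → x ∈ range b := by
  classical
  let E (i : ℕ) (j : κ) : L.Formula (Fin k ⊕ (κ ⊕ ℕ)) :=
    Term.equal (.var (.inr (.inr i))) (.var (.inr (.inl j)))
  have hE : ∀ i j b a, (E i j).Realize (Sum.elim c (Sum.elim b a)) ↔ a i = b j :=
    fun i j b a => Formula.realize_equal
  let g (i : ℕ) : Fin k ⊕ Fin 1 → Fin k ⊕ (κ ⊕ ℕ) := Sum.map id fun _ => .inr i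
  have hg : ∀ i (b : κ → M) (a : ℕ → M),
      Sum.elim c (Sum.elim b a) ∘ g i = Sum.elim c fun _ => a i := by
    intro i b a
    funext j
    rcases j with j | j <;> rfl
  obtain ⟨b, a, hb, ha, N, hN, hcN, hbN⟩ := hM.exists_generic_model c b₀
    (fun i : ℕ => {ψ | (∃ j, ψ = E i j) ∨ ∃ δ ∈ tp1 L c a₀, ψ = (δ.relabel (g i)).not}) (by
      intro i φ a hφ
      obtain ⟨s, φ', hφ'⟩ := exists_finset_support (M := M) φ
      let t : Finset κ := insert (Classical.arbitrary κ) s.toRight.toLeft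
      let β : Fin t.card → M := fun j => b₀ (t.equivFin.symm j)
      let h : s → (Fin (k + t.card) ⊕ Fin 1) ⊕ ℕ := fun y => match y with
        | ⟨.inl j, _⟩ => .inl (.inl (Fin.castAdd _ j))
        | ⟨.inr (.inl j), hj⟩ => .inl (.inl (Fin.natAdd _ (t.equivFin ⟨j, by
            simpa [t] using Or.inr hj⟩)))
        | ⟨.inr (.inr l), _⟩ => if l = i then .inl (.inr 0) else .inr l
      have hh : ∀ (x : M) (w : ℕ → M),
          Sum.elim (Sum.elim (Fin.append c β) fun _ => x) w ∘ h =
            fun y : s => Sum.elim c (Sum.elim b₀ (Function.update w i x)) y := by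
        intro x w
        funext y
        obtain ⟨y | y | y, hy⟩ := y
        · exact Fin.append_left c β y
        · exact (Fin.append_right c β _).trans
            (congrArg (fun j : t => b₀ j) (Equiv.symm_apply_apply _ _))
        · change Sum.elim (Sum.elim (Fin.append c β) fun _ => x) w
            (if y = i then .inl (.inr 0) else .inr y) = Function.update w i x y
          by_cases hyi : y = i
          · rw [if_pos hyi, hyi, Function.update_self]
            rfl
          · rw [if_neg hyi, Function.update_of_ne hyi]
            rfl
      obtain ⟨χ, hχ⟩ := exists_formula_exists (M := M) (φ'.relabel h)
      have hχ' : ∀ x, χ.Realize (Sum.elim (Fin.append c β) fun _ => x) ↔ ∃ w : ℕ → M,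
          φ.Realize (Sum.elim c (Sum.elim b₀ (Function.update w i x))) := by
        intro x
        rw [hχ]
        simp only [Formula.realize_relabel, hh, hφ']
      obtain ⟨N, hN⟩ := hM.exists_isPrimeOver hs (Fin.append c β)
      have hx : ∃ x : N, χ.Realize (Sum.elim (Fin.append c β) fun _ => (x : M)) := by
        let e : Fin (k + t.card) → N := fun i => ⟨_, hN.1 i⟩
        have hex : (χ.iExs (Fin 1)).Realize (Fin.append c β) :=
          Formula.realize_iExs.2 ⟨fun _ => a i, (hχ' _).2 ⟨a, by simpa using hφ⟩⟩
        obtain ⟨x, hx⟩ := Formula.realize_iExs.1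
          ((N.subtype.map_formula (χ.iExs (Fin 1)) e).1 hex)
        refine ⟨x 0, ?_⟩
        have := (N.subtype.map_formula χ _).2 hx
        convert this using 1
        funext y
        rcases y with y | y
        · rfl
        · simp [Subsingleton.elim y 0]
      obtain ⟨x, hx⟩ := hx
      obtain ⟨w, hw⟩ := (hχ' x).1 hx
      refine ⟨_, hw, ?_⟩
      by_cases hxp : (x : M) ∈ pSet L c a₀
      · have := htriv t.card (Finset.card_pos.2 ⟨_, Finset.mem_insert_self _ _⟩) β
          (fun j => hb₀ _) N hN
        obtain ⟨j, hj⟩ : (x : M) ∈ range β := this ▸ ⟨hxp, x.2⟩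
        exact ⟨E i (t.equivFin.symm j), Or.inl ⟨_, rfl⟩,
          (hE _ _ _ _).2 (by rw [Function.update_self]; exact hj.symm)⟩
      · obtain ⟨δ, hδ, hδx⟩ : ∃ δ ∈ tp1 L c a₀, δ ∉ tp1 L c (x : M) := by
          refine Set.not_subset.1 fun hsub => hxp ?_
          exact (tpT_eq_of_subset (c := c) (a := fun _ : Fin 1 => a₀) hsub).symm
        refine ⟨_, Or.inr ⟨δ, hδ, rfl⟩, Formula.realize_not.2 ?_⟩
        rw [Formula.realize_relabel, hg, Function.update_self]
        exact hδx)
  refine ⟨b, N, hb, ((Set.countable_range a).mono fun x hx => (hN x).1 hx).to_subtype, hcN, hbN,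
    fun x hx hxp => ?_⟩
  obtain ⟨i, rfl⟩ := (hN x).1 hx
  obtain ⟨ψ, ⟨j, rfl⟩ | ⟨δ, hδ, rfl⟩, hψ⟩ := ha i
  · exact ⟨j, ((hE _ _ _ _).1 hψ).symm⟩
  · rw [Formula.realize_not, Formula.realize_relabel, hg] at hψ
    change tp1 L c _ = tp1 L c a₀ at hxp
    rw [← hxp] at hδ
    exact (hψ hδ).elim

end Prime


section OrderTypes

/-- The points of `ℕ ×ₗ ℚ` whose `n`-th fibre is `(n + 1, ∞)`, preceded by the finite chain
`0, …, n + 1` when `n ∈ X`. -/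
def codeSet (X : Set ℕ) : Set (ℕ ×ₗ ℚ) :=
  {p | ((ofLex p).1 : ℚ) + 1 < (ofLex p).2 ∨
    (ofLex p).1 ∈ X ∧ ∃ i ≤ (ofLex p).1 + 1, (ofLex p).2 = (i : ℕ)}

/-- The lengths of the maximal finite successor chains in a linear order. -/
def chainLengths (I : Type*) [LinearOrder I] : Set ℕ :=
  {n | ∃ g : ℕ → I, (∀ i ≤ n, g i ⋖ g (i + 1)) ∧ (∀ y, ¬ y ⋖ g 0) ∧ ∀ y, ¬ g (n + 1) ⋖ y}

theorem chainLengths_subset_of_orderIso {I I' : Type*} [LinearOrder I] [LinearOrder I']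
    (f : I ≃o I') : chainLengths I ⊆ chainLengths I' := by
  rintro n ⟨g, h1, h2, h3⟩
  refine ⟨f ∘ g, fun i hi => (apply_covBy_apply_iff f).2 (h1 i hi), fun y hy => ?_, fun y hy => ?_⟩
  · refine h2 (f.symm y) ((apply_covBy_apply_iff f).1 ?_)
    rwa [f.apply_symm_apply]
  · refine h3 (f.symm y) ((apply_covBy_apply_iff f).1 ?_)
    rwa [f.apply_symm_apply]

theorem codeSet_covBy {X : Set ℕ} {x y : codeSet X} (h : x ⋖ y) :
    ∃ m ∈ X, ∃ i ≤ m, x.1 = toLex (m, (i : ℚ)) ∧ y.1 = toLex (m, ((i + 1 : ℕ) : ℚ)) := by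
  obtain ⟨⟨m, q⟩, hx⟩ := x
  obtain ⟨⟨m', q'⟩, hy⟩ := y
  change codeSet X (toLex (m, q)) at hx
  change codeSet X (toLex (m', q')) at hy
  have hlt : toLex (m, q) < toLex (m', q') := h.1
  have hno : ∀ z ∈ codeSet X, toLex (m, q) < z → ¬ z < toLex (m', q') :=
    fun z hz h1 h2 => h.2 (c := ⟨z, hz⟩) h1 h2
  rw [Prod.Lex.toLex_lt_toLex] at hlt
  rcases le_or_gt ((m : ℚ) + 1) q with hq | hq
  · exfalso
    rcases hlt with hm | ⟨hm, hqq⟩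
    · refine hno (toLex (m, q + 1)) (Or.inl ?_) ?_ ?_
      · change (m : ℚ) + 1 < q + 1
        linarith
      · exact Prod.Lex.toLex_lt_toLex.2 (Or.inr ⟨rfl, by simp⟩)
      · exact Prod.Lex.toLex_lt_toLex.2 (Or.inl hm)
    · dsimp only at hm hqq
      refine hno (toLex (m, (q + q') / 2)) (Or.inl ?_) ?_ ?_
      · change (m : ℚ) + 1 < (q + q') / 2
        linarith
      · exact Prod.Lex.toLex_lt_toLex.2 (Or.inr ⟨rfl, by change q < (q + q') / 2; linarith⟩)
      · exact Prod.Lex.toLex_lt_toLex.2 (Or.inr ⟨hm, by change (q + q') / 2 < q'; linarith⟩)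
  · rcases hx with hx | ⟨hmX, i, him, hi⟩
    · exact absurd hx (not_lt.2 hq.le)
    change m ∈ X at hmX
    change q = i at hi
    subst hi
    have him' : i ≤ m := by
      have : (i : ℚ) < (m + 1 : ℕ) := by push_cast; exact hq
      exact Nat.lt_succ_iff.1 (Nat.cast_lt.1 this)
    have hle := not_lt.1 fun h2 => hno (toLex (m, ((i + 1 : ℕ) : ℚ)))
      (Or.inr ⟨hmX, i + 1, Nat.succ_le_succ him', rfl⟩)
      (Prod.Lex.toLex_lt_toLex.2 (Or.inr ⟨rfl, by simp⟩)) h2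
    rw [Prod.Lex.toLex_le_toLex] at hle
    dsimp only at hle hlt
    obtain ⟨rfl, hiq⟩ : m = m' ∧ (i : ℚ) < q' := by
      rcases hlt with h1 | h1
      · rcases hle with h2 | h2 <;> omega
      · exact h1
    have hqi : q' ≤ ((i + 1 : ℕ) : ℚ) := by
      rcases hle with h2 | h2
      · omega
      · exact h2.2
    refine ⟨m, hmX, i, him', rfl, ?_⟩
    rcases hy with hy | ⟨-, j, -, hj⟩
    · change (m : ℚ) + 1 < q' at hy
      have : ((i + 1 : ℕ) : ℚ) ≤ (m + 1 : ℕ) := Nat.cast_le.2 (by omega)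
      push_cast at this hqi
      linarith
    · change q' = j at hj
      subst hj
      have h1 := Nat.cast_lt.1 hiq
      have h2 := Nat.cast_le.1 hqi
      obtain rfl : j = i + 1 := by omega
      rfl

theorem codeSet_mem {X : Set ℕ} {m i : ℕ} (hm : m ∈ X) (hi : i ≤ m + 1) :
    toLex (m, (i : ℚ)) ∈ codeSet X :=
  Or.inr ⟨hm, i, hi, rfl⟩

theorem codeSet_covBy_succ {X : Set ℕ} {m i : ℕ} (hm : m ∈ X) (hi : i ≤ m) :
    (⟨_, codeSet_mem hm (Nat.le_succ_of_le hi)⟩ : codeSet X) ⋖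
      ⟨_, codeSet_mem hm (Nat.succ_le_succ hi)⟩ := by
  refine ⟨Prod.Lex.toLex_lt_toLex.2 (Or.inr ⟨rfl, by simp⟩), ?_⟩
  rintro ⟨⟨m', q⟩, hz⟩ h1 h2
  have h1' : toLex (m, (i : ℚ)) < toLex (m', q) := h1
  have h2' : toLex (m', q) < toLex (m, ((i + 1 : ℕ) : ℚ)) := h2
  rw [Prod.Lex.toLex_lt_toLex] at h1' h2'
  dsimp only at h1' h2'
  obtain rfl : m = m' := by omega
  simp only [lt_irrefl, false_or, true_and] at h1' h2'
  rcases hz with hz | ⟨-, j, -, hj⟩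
  · change (m : ℚ) + 1 < q at hz
    have : ((i + 1 : ℕ) : ℚ) ≤ (m + 1 : ℕ) := Nat.cast_le.2 (by omega)
    push_cast at this h2'
    linarith
  · change q = j at hj
    subst hj
    have h1 := Nat.cast_lt.1 h1'
    have h2 := Nat.cast_lt.1 h2'
    omega

theorem toLex_natCast_inj {m m' i i' : ℕ}
    (h : (toLex (m, (i : ℚ)) : ℕ ×ₗ ℚ) = toLex (m', (i' : ℚ))) : m = m' ∧ i = i' := by
  have := toLex_inj.1 h
  simpa using this

theorem chainLengths_codeSet (X : Set ℕ) : chainLengths (codeSet X) = X := by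
  ext n
  constructor
  · rintro ⟨g, h1, h2, h3⟩
    obtain ⟨m, hm, i₀, hi₀, h0, -⟩ := codeSet_covBy (h1 0 (Nat.zero_le _))
    obtain rfl : i₀ = 0 := by
      by_contra hne
      obtain ⟨i, rfl⟩ := Nat.exists_eq_succ_of_ne_zero hne
      have := codeSet_covBy_succ hm (Nat.le_of_succ_le hi₀)
      rw [show (⟨_, codeSet_mem hm (Nat.le_succ_of_le hi₀)⟩ : codeSet X) = g 0 from Subtype.ext h0.symm] at this
      exact h2 _ this
    have hg : ∀ j ≤ n + 1, (g j).1 = toLex (m, (j : ℚ)) := by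
      intro j hj
      induction j with
      | zero => exact h0
      | succ j ih =>
        obtain ⟨m', -, i, -, h4, h5⟩ := codeSet_covBy (h1 j (by omega))
        rw [ih (by omega)] at h4
        obtain ⟨rfl, rfl⟩ := toLex_natCast_inj h4
        exact h5
    obtain ⟨m', -, i, hi, h4, -⟩ := codeSet_covBy (h1 n le_rfl)
    rw [hg n (by omega)] at h4
    obtain ⟨rfl, rfl⟩ := toLex_natCast_inj h4
    rcases hi.eq_or_lt with rfl | hlt
    · exact hm
    · have := codeSet_covBy_succ hm (Nat.succ_le_of_lt hlt)
      rw [show (⟨_, codeSet_mem hm (Nat.succ_le_succ hi)⟩ : codeSet X) = g (n + 1) from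
        Subtype.ext (hg (n + 1) le_rfl).symm] at this
      exact (h3 _ this).elim
  · intro hn
    refine ⟨fun i => ⟨_, codeSet_mem hn (min_le_right i (n + 1))⟩, fun i hi => ?_, fun y hy => ?_,
      fun y hy => ?_⟩
    · have := codeSet_covBy_succ hn hi
      simp only [min_eq_left (Nat.le_succ_of_le hi), min_eq_left (Nat.succ_le_succ hi)]
      exact this
    · obtain ⟨m, -, i, -, -, h⟩ := codeSet_covBy hy
      have := (toLex_natCast_inj h).2
      simp at this
    · obtain ⟨m, -, i, hi, h, -⟩ := codeSet_covBy hy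
      obtain ⟨rfl, rfl⟩ := toLex_natCast_inj h
      simp at hi

theorem eq_of_codeSet_orderIso {X Y : Set ℕ} (f : codeSet X ≃o codeSet Y) : X = Y := by
  rw [← chainLengths_codeSet X, ← chainLengths_codeSet Y]
  exact (chainLengths_subset_of_orderIso f).antisymm (chainLengths_subset_of_orderIso f.symm)

theorem nonempty_codeSet (X : Set ℕ) : Nonempty (codeSet X) :=
  ⟨⟨toLex (0, 2), Or.inl (by change ((0 : ℕ) : ℚ) + 1 < 2; norm_num)⟩⟩

theorem countable_codeSet (X : Set ℕ) : Countable (codeSet X) :=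
  have : Countable (ℕ ×ₗ ℚ) := inferInstanceAs (Countable (ℕ × ℚ))
  inferInstance

end OrderTypes

section Chains

variable {L} {M : Type w} [L.Structure M]

theorem infinite_setOf_realize {k : ℕ} {c : Fin k → M} {a₀ : M} (h : ¬ IsPrincipal1 L c a₀)
    {φ : L.Formula (Fin k ⊕ Fin 1)} (hφ : φ ∈ tp1 L c a₀) :
    {x | φ.Realize (Sum.elim c fun _ => x)}.Infinite := by
  intro hfin
  induction hn : {x | φ.Realize (Sum.elim c fun _ => x)}.ncard using Nat.strong_induction_on
    generalizing φ with
  | _ n ih =>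
    subst hn
    refine h ⟨φ, hφ, fun a' ha' => ?_⟩
    by_contra hne
    obtain ⟨ψ, hψ, hψ'⟩ := Set.not_subset.1 fun hsub => hne
      (tpT_eq_of_subset (c := c) (a := fun _ : Fin 1 => a₀) hsub).symm
    have hss : {x | (φ ⊓ ψ).Realize (Sum.elim c fun _ => x)} ⊂
        {x | φ.Realize (Sum.elim c fun _ => x)} :=
      ⟨fun x hx => (Formula.realize_inf.1 hx).1, fun hx =>
        hψ' (Formula.realize_inf.1 (hx ha')).2⟩
    exact ih _ (Set.ncard_lt_ncard hss hfin) (Formula.realize_inf.2 ⟨hφ, hψ⟩)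
      (hfin.subset hss.1) rfl

/-- The formula `i < j`. -/
def ltFormula [IsOrdered L] {α : Type*} (i j : α) : L.Formula α :=
  Term.lt (.var (.inl i)) (.var (.inl j))

theorem realize_ltFormula [IsOrdered L] [LinearOrder M] [L.OrderedStructure M] {α : Type*}
    {i j : α} {v : α → M} : (ltFormula i j : L.Formula α).Realize v ↔ v i < v j :=
  Term.realize_lt

theorem exists_strictMonoOn_of_infinite {κ : Type*} [LinearOrder κ] [LinearOrder M] {R : Set M}
    (hR : R.Infinite) (s : Finset κ) : ∃ w : κ → M, StrictMonoOn w s ∧ ∀ i ∈ s, w i ∈ R := by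
  obtain ⟨t, ht, hts⟩ := hR.exists_subset_card_eq s.card
  obtain ⟨x, -⟩ := hR.nonempty
  refine ⟨fun i => if h : i ∈ s then t.orderEmbOfFin hts ((s.orderIsoOfFin rfl).symm ⟨i, h⟩) else x,
    fun i hi j hj hij => ?_, fun i hi => ?_⟩
  · have hi' : i ∈ s := hi
    have hj' : j ∈ s := hj
    simpa [hi', hj'] using hij
  · simp only [dif_pos hi]
    exact ht (Finset.orderEmbOfFin_mem t hts _)

theorem OmegaSaturated.exists_strictMono [IsOrdered L] [LinearOrder M] [L.OrderedStructure M]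
    (hM : OmegaSaturated L M) [Nonempty M] {k : ℕ} {c : Fin k → M} {a₀ : M}
    (h : ¬ IsPrincipal1 L c a₀) (κ : Type*) [LinearOrder κ] [Countable κ] :
    ∃ b : κ → M, StrictMono b ∧ ∀ i, b i ∈ pSet L c a₀ := by
  classical
  have hw : ∀ x : Finset κ × Finset (tp1 L c a₀), ∃ w : κ → M, StrictMonoOn w x.1 ∧
      ∀ i ∈ x.1, ∀ φ ∈ x.2, φ.1.Realize (Sum.elim c fun _ => w i) := by
    rintro ⟨s, Δ⟩
    have hΔ : Formula.iInf (fun φ : Δ => φ.1.1) ∈ tp1 L c a₀ :=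
      BoundedFormula.realize_iInf.2 fun φ => φ.1.2
    obtain ⟨w, hw, hwR⟩ := exists_strictMonoOn_of_infinite (infinite_setOf_realize h hΔ) s
    exact ⟨w, hw, fun i hi φ hφ => BoundedFormula.realize_iInf.1 (hwR i hi) ⟨φ, hφ⟩⟩
  choose w hmono hreal using hw
  obtain ⟨b, hb⟩ := hM.exists_limit c (Filter.map w Filter.atTop)
  refine ⟨b, fun i j hij => ?_, fun i => (tpT_eq_of_subset (c := c) (a := fun _ : Fin 1 => a₀)
    fun φ hφ => ?_).symm⟩
  · have := hb (ltFormula (.inr i) (.inr j)) (Filter.eventually_map.2 (by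
      filter_upwards [Filter.eventually_ge_atTop ({i, j}, ∅)] with x hx
      have hx1 : {i, j} ⊆ x.1 := hx.1
      exact realize_ltFormula.2 (hmono x (hx1 (by simp)) (hx1 (by simp)) hij)))
    rwa [realize_ltFormula] at this
  · have key : ∀ v : κ → M, Sum.elim c v ∘ Sum.map id (fun _ : Fin 1 => i) =
        Sum.elim c fun _ => v i := by
      intro v
      funext j
      rcases j with j | j <;> rfl
    have := hb (φ.relabel (Sum.map id fun _ => i)) (Filter.eventually_map.2 (by
      filter_upwards [Filter.eventually_ge_atTop ({i}, {⟨φ, hφ⟩})] with x hx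
      have hx1 : {i} ⊆ x.1 := hx.1
      have hx2 : {⟨φ, hφ⟩} ⊆ x.2 := hx.2
      rw [Formula.realize_relabel, key]
      exact hreal x i (hx1 (by simp)) ⟨φ, hφ⟩ (hx2 (by simp))))
    rwa [Formula.realize_relabel, key] at this

end Chains

section Isomorphisms

variable {L} {M : Type w} [L.Structure M]

theorem realize_coe_equiv {N N' : L.ElementarySubstructure M} (f : N ≃[L] N') {α : Type*}
    (φ : L.Formula α) (v : α → N) :
    φ.Realize (fun i => (f (v i) : M)) ↔ φ.Realize fun i => (v i : M) :=
  (N'.subtype.map_formula φ (f ∘ v)).trans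
    ((StrongHomClass.realize_formula f φ).trans (N.subtype.map_formula φ v).symm)

theorem tp1_coe_equiv {N N' : L.ElementarySubstructure M} (f : N ≃[L] N') {k : ℕ} {c : Fin k → M}
    {hc : ∀ i, c i ∈ N} (hfc : ∀ i, (f ⟨c i, hc i⟩ : M) = c i) (x : N) :
    tp1 L c (f x : M) = tp1 L c (x : M) := by
  let v : Fin k ⊕ Fin 1 → N := Sum.elim (fun i => ⟨c i, hc i⟩) fun _ => x
  have h1 : (fun i => (f (v i) : M)) = Sum.elim c fun _ => (f x : M) := by
    funext i
    rcases i with i | i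
    · exact hfc i
    · rfl
  have h2 : (fun i => (v i : M)) = Sum.elim c fun _ => (x : M) := by
    funext i
    rcases i with i | i <;> rfl
  ext φ
  have := realize_coe_equiv f φ v
  rwa [h1, h2] at this

theorem nonempty_orderIso_of_equiv [IsOrdered L] [LinearOrder M] [L.OrderedStructure M]
    {N N' : L.ElementarySubstructure M} (f : N ≃[L] N') {k : ℕ} {c : Fin k → M} {a₀ : M}
    {hc : ∀ i, c i ∈ N} (hfc : ∀ i, (f ⟨c i, hc i⟩ : M) = c i)
    {κ κ' : Type*} [LinearOrder κ] [LinearOrder κ'] {b : κ → M} {b' : κ' → M}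
    (hb : StrictMono b) (hb' : StrictMono b')
    (hbN : ∀ x, x ∈ range b ↔ x ∈ N ∧ x ∈ pSet L c a₀)
    (hbN' : ∀ x, x ∈ range b' ↔ x ∈ N' ∧ x ∈ pSet L c a₀) : Nonempty (κ ≃o κ') := by
  have hf : ∀ x y : N, (x : M) < y → (f x : M) < f y := by
    intro x y hxy
    have := (realize_coe_equiv f (ltFormula 0 1 : L.Formula (Fin 2)) ![x, y]).2
      (realize_ltFormula.2 hxy)
    rwa [realize_ltFormula] at this
  have hmem : ∀ i, b i ∈ N := fun i => ((hbN _).1 ⟨i, rfl⟩).1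
  have hmono : StrictMono fun i => (f ⟨b i, hmem i⟩ : M) := fun i j hij => hf _ _ (hb hij)
  refine ⟨(hmono.orderIso _).trans ((OrderIso.setCongr _ _ ?_).trans (hb'.orderIso _).symm)⟩
  ext x
  rw [hbN']
  constructor
  · rintro ⟨i, rfl⟩
    exact ⟨SetLike.coe_mem _, (tp1_coe_equiv f hfc _).trans ((hbN _).1 ⟨i, rfl⟩).2⟩
  · rintro ⟨hx, hxp⟩
    have h := tp1_coe_equiv f hfc (f.symm ⟨x, hx⟩)
    rw [f.apply_symm_apply] at h
    obtain ⟨i, hi⟩ := (hbN _).2 ⟨(f.symm ⟨x, hx⟩).2, h.symm.trans hxp⟩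
    refine ⟨i, ?_⟩
    have : (⟨b i, hmem i⟩ : N) = f.symm ⟨x, hx⟩ := Subtype.ext hi
    change (f ⟨b i, hmem i⟩ : M) = x
    rw [this, f.apply_symm_apply]

end Isomorphisms

section Counting

variable {L} {M : Type w} [L.Structure M]

theorem exists_injective_realized_types (hM : OmegaSaturated L M) [Nonempty M] [Countable L.Symbols]
    {n : ℕ} (h : ¬ (range fun v : Fin n → M => tp0 L v).Countable) :
    ∃ v : Set ℕ → Fin n → M, Function.Injective fun s => tp0 L (v s) := by
  classical
  let χ : (Fin n → M) → L.Formula (Fin n) → Bool := fun v φ => decide (φ.Realize v)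
  have hχ : ∀ v v', χ v = χ v' ↔ tp0 L v = tp0 L v' := by
    intro v v'
    simp only [funext_iff, χ, decide_eq_decide, Set.ext_iff]
    rfl
  have hclosed : IsClosed (range χ) := by
    refine isClosed_of_closure_subset fun y hy => ?_
    obtain ⟨x, hx, hlim⟩ := mem_closure_iff_seq_limit.1 hy
    choose v hv using hx
    have hev : ∀ φ, ∀ᶠ i in Filter.atTop, χ (v i) φ = y φ := by
      intro φ
      have := tendsto_pi_nhds.1 hlim φ
      simp only [← hv] at this
      simpa [nhds_discrete] using this
    obtain ⟨z, hz⟩ := hM.exists_limit (Fin.elim0 : Fin 0 → M) (Filter.map v Filter.atTop)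
    have hz' : ∀ φ : L.Formula (Fin n), (∀ᶠ i in Filter.atTop, φ.Realize (v i)) →
        φ.Realize z := by
      intro φ hφ
      have := hz (φ.relabel .inr) (Filter.eventually_map.2 (by
        filter_upwards [hφ] with i hi
        rwa [Formula.realize_relabel, Sum.elim_comp_inr]))
      rwa [Formula.realize_relabel, Sum.elim_comp_inr] at this
    refine ⟨z, funext fun φ => ?_⟩
    cases hy : y φ with
    | true =>
      refine decide_eq_true (hz' φ ?_)
      filter_upwards [hev φ] with i hi
      exact of_decide_eq_true (hi.trans hy)
    | false =>
      refine decide_eq_false (Formula.realize_not.1 (hz' φ.not ?_))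
      filter_upwards [hev φ] with i hi
      exact Formula.realize_not.2 (of_decide_eq_false (hi.trans hy))
  have hunc : ¬ (range χ).Countable := by
    refine fun hc => h ((hc.image fun f => {φ | f φ = true}).mono ?_)
    rintro _ ⟨v, rfl⟩
    refine ⟨_, ⟨v, rfl⟩, ?_⟩
    ext φ
    exact decide_eq_true_iff
  have : PolishSpace (L.Formula (Fin n) → Bool) := {}
  obtain ⟨f, hf, -, hinj⟩ := hclosed.exists_nat_bool_injection_of_not_countable hunc
  choose v hv using fun x => hf (mem_range_self x)
  refine ⟨fun s => v fun i => decide (i ∈ s), fun s t hst => ?_⟩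
  have := hinj (((hv _).symm.trans ((hχ _ _).2 hst)).trans (hv _))
  ext i
  simpa using congrFun this i

theorem OmegaSaturated.exists_countable_elementarySubstructure (hM : OmegaSaturated L M)
    [Nonempty M] [Countable L.Symbols] {n : ℕ} (v : Fin n → M) :
    ∃ N : L.ElementarySubstructure M, Countable N ∧ ∀ i, v i ∈ N := by
  obtain ⟨-, a, -, -, N, hN, hv, -⟩ := hM.exists_generic_model v (Empty.elim : Empty → M)
    (Empty.elim : Empty → Set (L.Formula (Fin n ⊕ (Empty ⊕ ℕ)))) fun j => j.elim
  exact ⟨N, ((Set.countable_range a).mono fun x hx => (hN x).1 hx).to_subtype, hv⟩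

/-- A family of countable elementary substructures indexed by the sets of natural numbers, in which
every isomorphism class is countable, contains continuum many isomorphism types. -/
theorem hasContinuumManyCountableModels_of_countable_classes {L : FirstOrder.Language.{u, v}}
    {M : Type w} [L.Structure M] [Nonempty M] (N : Set ℕ → L.ElementarySubstructure M)
    (hN : ∀ s, Countable (N s)) (hcls : ∀ t, {s | Nonempty (N s ≃[L] N t)}.Countable) :
    HasContinuumManyCountableModels L (L.completeTheory M) := by
  let r : Setoid (Set ℕ) :=
    { r := fun s t => Nonempty (N s ≃[L] N t)
      iseqv := ⟨fun s => ⟨.refl L _⟩, fun ⟨f⟩ => ⟨f.symm⟩, fun ⟨f⟩ ⟨g⟩ => ⟨g.comp f⟩⟩ }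
  have hQ : Cardinal.continuum ≤ Cardinal.mk (Quotient r) := by
    by_contra! hlt
    have h1 : Cardinal.mk (Set ℕ) ≤ Cardinal.mk (Quotient r) * Cardinal.aleph0 := by
      rw [← Cardinal.mk_congr (Equiv.sigmaFiberEquiv (Quotient.mk r)), Cardinal.mk_sigma,
        ← Cardinal.sum_const']
      refine Cardinal.sum_le_sum _ _ fun q => ?_
      obtain ⟨t, rfl⟩ := Quotient.exists_rep q
      have := (hcls t).mono fun s (hs : Quotient.mk r s = Quotient.mk r t) => Quotient.exact hs
      exact Cardinal.mk_le_aleph0_iff.2 this.to_subtype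
    rw [Cardinal.mk_set, Cardinal.mk_nat, Cardinal.two_power_aleph0] at h1
    refine (h1.trans (Cardinal.mul_le_max _ _)).not_gt ?_
    simp [hlt, Cardinal.aleph0_lt_continuum]
  have hQ' : Cardinal.mk (Set ℕ) ≤ Cardinal.mk (Quotient r) := by
    rwa [Cardinal.mk_set, Cardinal.mk_nat, Cardinal.two_power_aleph0]
  obtain ⟨q⟩ := hQ'
  let P : Set ℕ → L.ElementarySubstructure M := fun s => N (q s).out
  have hP : ∀ s, Countable (P s) := fun s => hN _
  have hsm : ∀ s, Small.{max u v} (P s) := fun s => Countable.toSmall _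
  let e : ∀ s, P s ≃ Shrink.{max u v} (P s) := fun s => equivShrink _
  let str : ∀ s, L.Structure (Shrink.{max u v} (P s)) := fun s => (e s).inducedStructure
  have iso : ∀ s, Nonempty (P s ≃[L] Shrink.{max u v} (P s)) :=
    fun s => ⟨(e s).inducedStructureEquiv⟩
  have hmod : ∀ s, Shrink.{max u v} (P s) ⊨ L.completeTheory M := by
    intro s
    obtain ⟨f⟩ := iso s
    exact StrongHomClass.theory_model f
  have hne : ∀ s, Nonempty (Shrink.{max u v} (P s)) := fun s => (e s).symm.nonempty
  refine ⟨fun s => Theory.ModelType.of _ (Shrink.{max u v} (P s)), fun s => ?_,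
    fun s t hst => ⟨fun f => hst (q.injective ?_)⟩⟩
  · exact Countable.of_equiv _ (e s)
  · obtain ⟨fs⟩ := iso s
    obtain ⟨ft⟩ := iso t
    have h : Nonempty (P s ≃[L] P t) := ⟨ft.symm.comp (f.comp fs)⟩
    rw [← Quotient.out_eq (q s), ← Quotient.out_eq (q t)]
    exact Quotient.sound h

end Counting

section Main

variable {L} {M : Type w} [L.Structure M]

theorem hasContinuumManyCountableModels_of_not_countable {L : FirstOrder.Language.{u, v}}
    {M : Type w} [L.Structure M] [Nonempty M] [Countable L.Symbols] (hM : OmegaSaturated L M)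
    {n : ℕ} (h : ¬ (range fun v : Fin n → M => tp0 L v).Countable) :
    HasContinuumManyCountableModels L (L.completeTheory M) := by
  obtain ⟨v, hv⟩ := exists_injective_realized_types hM h
  choose N hN hvN using fun s => hM.exists_countable_elementarySubstructure (v s)
  refine hasContinuumManyCountableModels_of_countable_classes N hN fun t => ?_
  choose f _ using fun s : {s | Nonempty (N s ≃[L] N t)} => exists_true_iff_nonempty.2 s.2
  have := hN t
  have hinj : Function.Injective fun s i => f s ⟨v s i, hvN s i⟩ := by
    intro s s' hss
    refine Subtype.ext (hv (Set.ext fun φ => ?_))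
    have h1 := realize_coe_equiv (f s) φ fun i => ⟨v s i, hvN s i⟩
    have h2 := realize_coe_equiv (f s') φ fun i => ⟨v s' i, hvN s' i⟩
    have h3 : ∀ i, f s ⟨v s i, hvN s i⟩ = f s' ⟨v s' i, hvN s' i⟩ := congrFun hss
    simp only [h3] at h1
    exact h1.symm.trans h2
  exact Set.countable_coe_iff.1 hinj.countable

theorem ExtremelyTrivial.hasContinuumManyCountableModels {L : FirstOrder.Language.{u, v}}
    [IsOrdered L] [Countable L.Symbols] {M : Type w} [L.Structure M] [LinearOrder M]
    [L.OrderedStructure M] [Nonempty M] {k : ℕ} {c : Fin k → M} {a₀ : M}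
    (htriv : ExtremelyTrivial L c a₀) (hM : OmegaSaturated L M) (hp : ¬ IsPrincipal1 L c a₀)
    (hs : ∀ n, (range fun v : Fin n → M => tp0 L v).Countable) :
    HasContinuumManyCountableModels L (L.completeTheory M) := by
  have key : ∀ X : Set ℕ, ∃ (b : codeSet X → M) (N : L.ElementarySubstructure M), StrictMono b ∧
      Countable N ∧ (∀ i, c i ∈ N) ∧ ∀ x, x ∈ range b ↔ x ∈ N ∧ x ∈ pSet L c a₀ := by
    intro X
    have := nonempty_codeSet X
    have := countable_codeSet X
    obtain ⟨b₀, hmono, hb₀⟩ := hM.exists_strictMono hp (codeSet X)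
    obtain ⟨b, N, hb, hN, hcN, hbN, hNb⟩ := hM.exists_model_pSet_eq_range hs htriv b₀ hb₀
    refine ⟨b, N, fun i j hij => ?_, hN, hcN, fun x => ⟨?_, fun h => hNb x h.1 h.2⟩⟩
    · have : ltFormula (.inr i) (.inr j) ∈ tpT L c b :=
        hb ▸ realize_ltFormula.2 (show Sum.elim c b₀ (.inr i) < Sum.elim c b₀ (.inr j) from
          hmono hij)
      exact (realize_ltFormula (v := Sum.elim c b)).1 this
    · rintro ⟨i, rfl⟩
      exact ⟨hbN i, (tpT_comp hb fun _ : Fin 1 => i).symm.trans (hb₀ i)⟩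
  choose b N hmono hN hcN hb using key
  refine hasContinuumManyCountableModels_of_countable_classes N hN fun t => ?_
  choose f _ using fun s : {s | Nonempty (N s ≃[L] N t)} => exists_true_iff_nonempty.2 s.2
  have := hN t
  have hinj : Function.Injective fun s i => f s ⟨c i, hcN s i⟩ := by
    intro s s' hss
    obtain ⟨e⟩ := nonempty_orderIso_of_equiv ((f s').symm.comp (f s)) (c := c) (a₀ := a₀)
      (hc := hcN s) (fun i => by
        have h3 : f s ⟨c i, hcN s i⟩ = f s' ⟨c i, hcN s' i⟩ := congrFun hss i
        change (((f s').symm (f s ⟨c i, hcN s i⟩) : N s') : M) = c i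
        rw [h3, Language.Equiv.symm_apply_apply])
      (hmono s) (hmono s') (hb s) (hb s')
    exact Subtype.ext (eq_of_codeSet_orderIso e)
  exact Set.countable_coe_iff.1 hinj.countable

end Main

/-- Theorem 5. Let `T = Th(M)` be a countable complete linearly
ordered theory. If there is a finite subset `A = range c` of a (sufficiently saturated)
model `M ⊨ T` and a non-principal extremely trivial type `p = tp(a₀/c) ∈ S₁(A)`, then `T`
has `2^{ℵ₀}` pairwise non-isomorphic countable models. -/
theorem statement_10 {L : FirstOrder.Language.{u, v}} [IsOrdered L]
    (hL : Countable L.Symbols)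
    {M : Type w} [L.Structure M] [LinearOrder M] [L.OrderedStructure M] [Nonempty M]
    (hMsat : OmegaSaturated L M)
    {k : ℕ} (c : Fin k → M) (a₀ : M)
    (hnonprinc : ¬ IsPrincipal1 L c a₀)
    (htriv : ExtremelyTrivial L c a₀) :
    HasContinuumManyCountableModels L (L.completeTheory M) := by
  have := hL
  by_cases hs : ∀ n, (range fun v : Fin n → M => tp0 L v).Countable
  · exact htriv.hasContinuumManyCountableModels hMsat hnonprinc hs
  · push Not at hs
    obtain ⟨n, hn⟩ := hs
    exact hasContinuumManyCountableModels_of_not_countable hMsat hn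

end Paper
end
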